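/- Let K be a real-symmetric compact subset of ℂ. Then the following are equivalent: (a) ℂ \ K is connected; (b) every real-symmetric function continuous on K and holomorphic on the interior of K is a uniform limit on K of real-symmetric algebraic polynomials; (c) every real-symmetric function continuous on K and holomorphic on the interior of K is a uniform limit on K of real-symmetric Dirichlet polynomials. -/

import Mathlib

open Complex Set

/-- A Dirichlet polynomial: a function of the form `z ↦ ∑_{k=1}^m a_k k^{-z}`. -/
def IsDirichletPolynomial (f : ℂ → ℂ) : Prop :=
  ∃ (m : ℕ) (a : ℕ → ℂ), ∀ z : ℂ, f z = ∑ k ∈ Finset.Icc 1 m, a k * (k : ℂ) ^ (-z)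

/-- The functions on `ℂ` that are, on `K`, uniform limits of members of the algebra `S`
of functions bounded on `K`. -/
def uniformClosureOn (S : Subalgebra ℂ (ℂ → ℂ)) (K : Set ℂ)
    (hS : ∀ p ∈ S, ∃ C : ℝ, ∀ z ∈ K, ‖p z‖ ≤ C) : Subalgebra ℂ (ℂ → ℂ) where
  carrier := {f | ∀ ε > 0, ∃ p ∈ S, ∀ z ∈ K, ‖f z - p z‖ < ε}
  algebraMap_mem' c ε hε := ⟨_, S.algebraMap_mem c, fun z _ => by simpa using hε⟩
  add_mem' {f g} hf hg ε hε := by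
    obtain ⟨p, hp, hpf⟩ := hf (ε / 2) (half_pos hε)
    obtain ⟨q, hq, hqg⟩ := hg (ε / 2) (half_pos hε)
    refine ⟨p + q, S.add_mem hp hq, fun z hz => ?_⟩
    calc ‖(f + g) z - (p + q) z‖ = ‖(f z - p z) + (g z - q z)‖ := by
          simp only [Pi.add_apply]; ring_nf
      _ ≤ ‖f z - p z‖ + ‖g z - q z‖ := norm_add_le _ _
      _ < ε := by linarith [hpf z hz, hqg z hz]
  mul_mem' {f g} hf hg ε hε := by
    obtain ⟨q₁, hq₁, hqg₁⟩ := hg 1 one_pos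
    obtain ⟨C₁, hC₁⟩ := hS q₁ hq₁
    obtain ⟨p, hp, hpf⟩ := hf (ε / 2 / (|C₁| + 1)) (by positivity)
    obtain ⟨C, hC⟩ := hS p hp
    obtain ⟨q, hq, hqg⟩ := hg (ε / 2 / (|C| + 1)) (by positivity)
    refine ⟨p * q, S.mul_mem hp hq, fun z hz => ?_⟩
    have hg1 : ‖g z‖ ≤ |C₁| + 1 := by
      have := norm_add_le (g z - q₁ z) (q₁ z)
      rw [sub_add_cancel] at this
      linarith [hqg₁ z hz, hC₁ z hz, le_abs_self C₁]
    have hp1 : ‖p z‖ ≤ |C| + 1 := by linarith [hC z hz, le_abs_self C]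
    have h1 : ‖f z - p z‖ * ‖g z‖ ≤ ‖f z - p z‖ * (|C₁| + 1) := by gcongr
    have h2 : ‖p z‖ * ‖g z - q z‖ ≤ (|C| + 1) * ‖g z - q z‖ := by gcongr
    have h3 : ‖f z - p z‖ * (|C₁| + 1) < ε / 2 := (lt_div_iff₀ (by positivity)).1 (hpf z hz)
    have h4 : ‖g z - q z‖ * (|C| + 1) < ε / 2 := (lt_div_iff₀ (by positivity)).1 (hqg z hz)
    calc ‖(f * g) z - (p * q) z‖ = ‖(f z - p z) * g z + p z * (g z - q z)‖ := by
          simp only [Pi.mul_apply]; ring_nf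
      _ ≤ ‖f z - p z‖ * ‖g z‖ + ‖p z‖ * ‖g z - q z‖ := by
          simpa only [norm_mul] using norm_add_le ((f z - p z) * g z) (p z * (g z - q z))
      _ < ε := by linarith

section uniformClosureOn

variable {S : Subalgebra ℂ (ℂ → ℂ)} {K : Set ℂ} {hS : ∀ p ∈ S, ∃ C : ℝ, ∀ z ∈ K, ‖p z‖ ≤ C}

lemma mem_uniformClosureOn_of_mem {f : ℂ → ℂ} (hf : f ∈ S) : f ∈ uniformClosureOn S K hS :=
  fun ε hε => ⟨f, hf, fun z _ => by simpa using hε⟩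

lemma mem_uniformClosureOn_of_approx {f : ℂ → ℂ}
    (h : ∀ ε > 0, ∃ g ∈ uniformClosureOn S K hS, ∀ z ∈ K, ‖f z - g z‖ < ε) :
    f ∈ uniformClosureOn S K hS := by
  intro ε hε
  obtain ⟨g, hg, hfg⟩ := h (ε / 2) (half_pos hε)
  obtain ⟨p, hp, hgp⟩ := hg (ε / 2) (half_pos hε)
  refine ⟨p, hp, fun z hz => ?_⟩
  have := norm_sub_le_norm_sub_add_norm_sub (f z) (g z) (p z)
  linarith [hfg z hz, hgp z hz]

lemma mem_uniformClosureOn_congr {f g : ℂ → ℂ} (hg : g ∈ uniformClosureOn S K hS)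
    (h : ∀ z ∈ K, f z = g z) : f ∈ uniformClosureOn S K hS :=
  mem_uniformClosureOn_of_approx fun ε hε => ⟨g, hg, fun z hz => by simpa [h z hz] using hε⟩

lemma const_mem_uniformClosureOn (c : ℂ) : (fun _ => c) ∈ uniformClosureOn S K hS :=
  (uniformClosureOn S K hS).algebraMap_mem c

/-- Composition with a function holomorphic on a disc. -/
lemma comp_mem_uniformClosureOn {h u : ℂ → ℂ} {ρ r : ℝ} (hρ : ρ < r)
    (hh : DifferentiableOn ℂ h (Metric.ball 0 r)) (hu : u ∈ uniformClosureOn S K hS)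
    (hur : ∀ z ∈ K, ‖u z‖ ≤ ρ) : (fun z => h (u z)) ∈ uniformClosureOn S K hS := by
  rcases K.eq_empty_or_nonempty with rfl | ⟨z₀, hz₀⟩
  · exact fun ε _ => ⟨0, S.zero_mem, by simp⟩
  have hρ0 : 0 ≤ ρ := (norm_nonneg _).trans (hur z₀ hz₀)
  obtain ⟨r₁, hr₁, hr₁r⟩ := exists_between hρ
  obtain ⟨r₂, hr₂, hr₂r⟩ := exists_between hr₁r
  lift r₁ to NNReal using hρ0.trans hr₁.le
  lift r₂ to NNReal using by linarith [r₁.coe_nonneg]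
  have hps := (hh.mono ((Metric.closedBall_subset_ball hr₂r))).hasFPowerSeriesOnBall
    (c := 0) (R := r₂) (by exact_mod_cast r₁.coe_nonneg.trans_lt hr₂)
  have := hps.tendstoUniformlyOn (r' := r₁) (by exact_mod_cast hr₂)
  rw [Metric.tendstoUniformlyOn_iff] at this
  refine mem_uniformClosureOn_of_approx fun ε hε => ?_
  obtain ⟨n, hn⟩ := (this ε hε).exists
  refine ⟨fun z => (cauchyPowerSeries h 0 r₂).partialSum n (u z), ?_, fun z hz => ?_⟩
  · have : (fun z => (cauchyPowerSeries h 0 r₂).partialSum n (u z))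
        = ∑ k ∈ Finset.range n, (cauchyPowerSeries h 0 r₂).coeff k • u ^ k := by
      ext z
      simp [FormalMultilinearSeries.partialSum, Finset.sum_apply, mul_comm]
    rw [this]
    exact Subalgebra.sum_mem _ fun k _ => Subalgebra.smul_mem _ (Subalgebra.pow_mem _ hu k) _
  · have hz' : u z ∈ Metric.ball (0 : ℂ) r₁ := by
      simpa using (hur z hz).trans_lt hr₁
    simpa [dist_eq_norm] using hn _ hz'

end uniformClosureOn

/-- The algebra of polynomial functions on `ℂ`. -/
noncomputable def polynomialAlgebra : Subalgebra ℂ (ℂ → ℂ) :=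
  (Polynomial.aeval (fun z : ℂ => z)).range

lemma mem_polynomialAlgebra {f : ℂ → ℂ} :
    f ∈ polynomialAlgebra ↔ ∃ p : Polynomial ℂ, ∀ z, f z = p.eval z := by
  have key (p : Polynomial ℂ) : Polynomial.aeval (fun z : ℂ => z) p = fun z => p.eval z := by
    ext z
    simp
  constructor
  · rintro ⟨p, rfl⟩
    exact ⟨p, fun z => congrFun (key p) z⟩
  · rintro ⟨p, hp⟩
    exact ⟨p, (key p).trans (funext fun z => (hp z).symm)⟩

lemma bounded_of_mem_polynomialAlgebra {K : Set ℂ} (hK : IsCompact K) :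
    ∀ p ∈ polynomialAlgebra, ∃ C : ℝ, ∀ z ∈ K, ‖p z‖ ≤ C := by
  intro f hf
  obtain ⟨p, hp⟩ := mem_polynomialAlgebra.1 hf
  obtain rfl : f = fun z => p.eval z := funext hp
  exact hK.exists_bound_of_continuousOn p.continuous.continuousOn

/-- The uniform closure of the polynomials on a compact set. -/
noncomputable def polynomialClosure {K : Set ℂ} (hK : IsCompact K) : Subalgebra ℂ (ℂ → ℂ) :=
  uniformClosureOn polynomialAlgebra K (bounded_of_mem_polynomialAlgebra hK)

lemma id_mem_polynomialClosure {K : Set ℂ} (hK : IsCompact K) :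
    (fun z => z) ∈ polynomialClosure hK :=
  mem_uniformClosureOn_of_mem (mem_polynomialAlgebra.2 ⟨Polynomial.X, by simp⟩)

lemma sub_const_mem_polynomialClosure {K : Set ℂ} (hK : IsCompact K) (c : ℂ) :
    (fun z => z - c) ∈ polynomialClosure hK :=
  Subalgebra.sub_mem _ (id_mem_polynomialClosure hK) (const_mem_uniformClosureOn c)

lemma inv_sub_mem_polynomialClosure {K : Set ℂ} (hK : IsCompact K) (hconn : IsConnected Kᶜ)
    {q : ℂ} (hq : q ∉ K) : (fun z => (z - q)⁻¹) ∈ polynomialClosure hK := by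
  have := isCompact_iff_compactSpace.1 hK
  let S := (polynomialFunctions K).topologicalClosure
  have hS : IsClosed (S : Set C(K, ℂ)) := Subalgebra.isClosed_topologicalClosure _
  let X : C(K, ℂ) := Polynomial.toContinuousMapOnAlgHom K Polynomial.X
  have hX : X ∈ S := Subalgebra.le_topologicalClosure _ ⟨Polynomial.X, by simp, rfl⟩
  have hspec : spectrum ℂ X = K := by
    rw [ContinuousMap.spectrum_eq_range]
    ext z
    simp [X]
  have hspec' : spectrum ℂ (⟨X, hX⟩ : S) = K := by
    have : IsClosed (S : Set C(K, ℂ)) := hS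
    rw [Subalgebra.spectrum_eq_of_isPreconnected_compl S ⟨X, hX⟩] <;> simp only [hspec]
    exact hconn.isPreconnected
  rw [← hspec', spectrum.notMem_iff] at hq
  obtain ⟨⟨G, hG⟩, hG'⟩ := hq.exists_right_inv
  have hGz (z : K) : (q - z) * G z = 1 := by
    have := congrArg (fun F : S => (F : C(K, ℂ)) z) hG'
    simpa [X, Algebra.algebraMap_eq_smul_one] using this
  intro ε hε
  obtain ⟨P, ⟨p, -, rfl⟩, hPG⟩ := Metric.mem_closure_iff.1 hG ε hε
  refine ⟨fun z => (-p).eval z, mem_polynomialAlgebra.2 ⟨-p, fun _ => rfl⟩, fun z hz => ?_⟩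
  have h1 := (ContinuousMap.dist_apply_le_dist (f := G)
    (g := Polynomial.toContinuousMapOnAlgHom K p) (⟨z, hz⟩ : K)).trans_lt hPG
  have h2 : (z - q)⁻¹ = - G ⟨z, hz⟩ := by
    refine inv_eq_of_mul_eq_one_right ?_
    linear_combination hGz ⟨z, hz⟩
  rw [dist_eq_norm, ← norm_neg] at h1
  change ‖(z - q)⁻¹ - (-p).eval z‖ < ε
  rw [h2]
  simpa [sub_eq_add_neg, add_comm] using h1

/-- The points `p` and `q` are the branch points of a continuous square root of
`(z - p) * (z - q)` on `K ∪ Y` which on `K` is a uniform limit of polynomials. -/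
def SqrtLinked {K : Set ℂ} (hK : IsCompact K) (Y : Set ℂ) (p q : ℂ) : Prop :=
  ∃ s : ℂ → ℂ, ContinuousOn s (K ∪ Y) ∧ s ∈ polynomialClosure hK ∧
    ∀ z ∈ K ∪ Y, s z ^ 2 = (z - p) * (z - q)

section SqrtLinked

variable {K : Set ℂ} {hK : IsCompact K} {Y : Set ℂ} {p q r : ℂ}

lemma SqrtLinked.refl (p : ℂ) : SqrtLinked hK Y p p :=
  ⟨fun z => z - p, by fun_prop, sub_const_mem_polynomialClosure hK p, fun z _ => sq _⟩

lemma SqrtLinked.symm (h : SqrtLinked hK Y p q) : SqrtLinked hK Y q p := by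
  obtain ⟨s, hc, hs, hsq⟩ := h
  exact ⟨s, hc, hs, fun z hz => by rw [hsq z hz, mul_comm]⟩

lemma SqrtLinked.trans (hconn : IsConnected Kᶜ) (hq : q ∉ K ∪ Y) (h₁ : SqrtLinked hK Y p q)
    (h₂ : SqrtLinked hK Y q r) : SqrtLinked hK Y p r := by
  obtain ⟨s, hc, hs, hsq⟩ := h₁
  obtain ⟨s', hc', hs', hsq'⟩ := h₂
  have hne (z : ℂ) (hz : z ∈ K ∪ Y) : z - q ≠ 0 := sub_ne_zero.2 fun h => hq (h ▸ hz)
  refine ⟨s * s' * fun z => (z - q)⁻¹, (hc.mul hc').mul (ContinuousOn.inv₀ (by fun_prop) hne),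
    Subalgebra.mul_mem _ (Subalgebra.mul_mem _ hs hs') (inv_sub_mem_polynomialClosure hK hconn
      fun h => hq (Or.inl h)), fun z hz => ?_⟩
  have := hne z hz
  simp only [Pi.mul_apply, mul_pow, hsq z hz, hsq' z hz]
  field_simp

lemma sqrtLinked_of_near (hconn : IsConnected Kᶜ) (hq : q ∉ K ∪ Y)
    (h : ∀ z ∈ K ∪ Y, 2 * ‖p - q‖ ≤ ‖z - q‖) : SqrtLinked hK Y p q := by
  have hne (z : ℂ) (hz : z ∈ K ∪ Y) : z - q ≠ 0 := sub_ne_zero.2 fun h => hq (h ▸ hz)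
  let u : ℂ → ℂ := fun z => (p - q) * (z - q)⁻¹
  have hu (z : ℂ) (hz : z ∈ K ∪ Y) : ‖u z‖ ≤ 1 / 2 := by
    rw [norm_mul, norm_inv, ← div_eq_mul_inv, div_le_iff₀ (norm_pos_iff.2 (hne z hz))]
    linarith [h z hz]
  have hslit (v : ℂ) (hv : ‖v‖ < 1) : 1 - v ∈ slitPlane := by
    refine Or.inl ?_
    have := (re_le_norm v)
    simp only [sub_re, one_re]
    linarith
  have huc : ContinuousOn u (K ∪ Y) :=
    continuousOn_const.mul (ContinuousOn.inv₀ (by fun_prop) hne)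
  refine ⟨(fun z => z - q) * fun z => (1 - u z) ^ (1 / 2 : ℂ), ?_, ?_, fun z hz => ?_⟩
  · refine ContinuousOn.mul (by fun_prop) ?_
    exact (continuousOn_const.sub huc).cpow_const fun z hz =>
      hslit _ ((hu z hz).trans_lt (by norm_num))
  · refine Subalgebra.mul_mem _ (sub_const_mem_polynomialClosure hK q) ?_
    refine comp_mem_uniformClosureOn (h := fun v => (1 - v) ^ (1 / 2 : ℂ)) (u := u)
      (ρ := 1 / 2) (r := 1) (by norm_num) ?_ ?_ fun z hz => hu z (Or.inl hz)
    · intro v hv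
      exact ((differentiableAt_const _).sub differentiableAt_id).cpow_const
        (hslit v (by simpa using hv)) |>.differentiableWithinAt
    · exact Subalgebra.mul_mem _ (const_mem_uniformClosureOn (p - q))
        (inv_sub_mem_polynomialClosure hK hconn fun h => hq (Or.inl h))
  · have := hne z hz
    have h2 : ((1 - u z) ^ (1 / 2 : ℂ)) ^ 2 = 1 - u z := by
      simp
    simp only [Pi.mul_apply, mul_pow, h2, u]
    field_simp
    ring

/-- From every point off `K`, a branch point at distance comparable to `δ` can be reached without
leaving the disc of radius `2 * δ`. -/
lemma exists_sqrtLinked (hconn : IsConnected Kᶜ) {x : ℂ} (hx : x ∉ K) {δ : ℝ} (hδ : 0 < δ) :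
    ∃ q, δ ≤ ‖q - x‖ ∧ ‖q - x‖ < 2 * δ ∧ SqrtLinked hK (Metric.ball x (2 * δ))ᶜ x q := by
  by_contra! hcon
  set Y := (Metric.ball x (2 * δ))ᶜ with hY
  have hW : IsOpen (K ∪ Y)ᶜ := by
    rw [compl_union, hY, compl_compl]
    exact hK.isClosed.isOpen_compl.inter Metric.isOpen_ball
  let V : Set ℂ := {q | q ∉ K ∪ Y ∧ SqrtLinked hK Y x q}
  have hVδ (q : ℂ) (hq : q ∈ V) : ‖q - x‖ < δ := by
    by_contra! h
    refine hcon q h ?_ hq.2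
    have := hq.1
    simpa [hY, dist_eq_norm] using fun h => this (Or.inr h)
  have hnear (q : ℂ) (hq : q ∉ K ∪ Y) : ∃ ρ > 0, ∀ q' ∈ Metric.ball q ρ,
      q' ∉ K ∪ Y ∧ SqrtLinked hK Y q' q := by
    obtain ⟨ρ, hρ, hball⟩ := Metric.isOpen_iff.1 hW q hq
    refine ⟨ρ / 2, half_pos hρ, fun q' hq' => ⟨hball (Metric.ball_subset_ball (by linarith) hq'),
      sqrtLinked_of_near hconn hq fun z hz => ?_⟩⟩
    have h1 : ρ ≤ ‖z - q‖ := by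
      by_contra! h
      exact hball (by simpa [dist_eq_norm] using h) hz
    rw [Metric.mem_ball, dist_eq_norm] at hq'
    linarith
  have hVo : IsOpen V := by
    refine Metric.isOpen_iff.2 fun q hq => ?_
    obtain ⟨ρ, hρ, h⟩ := hnear q hq.1
    exact ⟨ρ, hρ, fun q' hq' => ⟨(h q' hq').1, hq.2.trans hconn hq.1 (h q' hq').2.symm⟩⟩
  have hxV : x ∈ V := ⟨by simp [hY, hx, hδ], SqrtLinked.refl x⟩
  have hsub : Kᶜ ⊆ V := by
    refine hconn.isPreconnected.subset_of_closure_inter_subset hVo ⟨x, hx, hxV⟩ ?_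
    rintro q ⟨hqV, hqK⟩
    have hqδ : ‖q - x‖ ≤ δ := by
      have : closure V ⊆ Metric.closedBall x δ :=
        closure_minimal (fun q hq => by simpa [dist_eq_norm] using (hVδ q hq).le)
          Metric.isClosed_closedBall
      simpa [dist_eq_norm] using this hqV
    have hqKY : q ∉ K ∪ Y := by
      have : ‖q - x‖ < 2 * δ := by linarith
      simpa [hY, dist_eq_norm, this] using hqK
    obtain ⟨ρ, hρ, h⟩ := hnear q hqKY
    obtain ⟨q', hq'V, hq'⟩ := Metric.mem_closure_iff.1 hqV ρ hρ
    have hq'b : q' ∈ Metric.ball q ρ := by rwa [Metric.mem_ball, dist_comm]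
    exact ⟨hqKY, hq'V.2.trans hconn hq'V.1 (h q' hq'b).2⟩
  refine NormedSpace.unbounded_univ ℂ ℂ ?_
  refine (hK.isBounded.union (Metric.isBounded_ball (x := x) (r := δ))).subset fun z _ => ?_
  by_cases hz : z ∈ K
  · exact Or.inl hz
  · exact Or.inr (by simpa [dist_eq_norm] using hVδ z (hsub hz))

end SqrtLinked

lemma isPreconnected_norm_sub_gt (m : ℂ) {ρ : ℝ} (hρ : 0 < ρ) :
    IsPreconnected {z : ℂ | ρ < ‖z - m‖} := by
  have h : {z : ℂ | ρ < ‖z - m‖} = (fun v => m + exp v) '' {v : ℂ | Real.log ρ < v.re} := by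
    ext z
    constructor
    · intro hz
      have hz0 : z - m ≠ 0 := norm_pos_iff.1 (hρ.trans hz)
      refine ⟨log (z - m), ?_, by simp [exp_log hz0]⟩
      rw [mem_ofPred_eq, log_re]
      exact Real.log_lt_log hρ hz
    · rintro ⟨v, hv, rfl⟩
      simp only [mem_ofPred_eq, add_sub_cancel_left, norm_exp]
      exact (Real.log_lt_iff_lt_exp hρ).1 hv
  rw [h]
  exact (convex_halfSpace_re_gt _).isPreconnected.image _ (by fun_prop)

lemma norm_kernel_sub_le_of_near {a w t s : ℂ} {δ : ℝ} (hδ : 0 < δ) (ha : δ / 2 ≤ ‖a‖)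
    (ha' : ‖a‖ ≤ δ) (hs : s ^ 2 = w ^ 2 - a ^ 2) (hw : ‖w‖ ≤ 6 * δ) (ht : ‖t‖ ≤ 3 * δ)
    (hwt : w - t ≠ 0) :
    ‖2 * (w - s) / a ^ 2 + t * (2 * (w - s) / a ^ 2) ^ 2 - (w - t)⁻¹‖ ≤
      3 * 10 ^ 7 * (‖w - t‖ * (1 + (‖w - t‖ / δ) ^ 2))⁻¹ := by
  have hsn : ‖s‖ ≤ 7 * δ := by
    have h1 : ‖s‖ ^ 2 ≤ ‖w‖ ^ 2 + ‖a‖ ^ 2 := by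
      rw [← norm_pow, hs, ← norm_pow, ← norm_pow]
      exact norm_sub_le _ _
    have : ‖s‖ ^ 2 ≤ (7 * δ) ^ 2 := by nlinarith [norm_nonneg w, norm_nonneg a]
    exact le_of_sq_le_sq this (by positivity)
  have hg : ‖2 * (w - s) / a ^ 2‖ ≤ 104 / δ := by
    have h1 : ‖w - s‖ ≤ 13 * δ := (norm_sub_le _ _).trans (by linarith)
    have h2 : (δ / 2) ^ 2 ≤ ‖a‖ ^ 2 := by gcongr
    rw [norm_div, norm_mul, norm_pow, RCLike.norm_ofNat]
    calc 2 * ‖w - s‖ / ‖a‖ ^ 2 ≤ 2 * (13 * δ) / (δ / 2) ^ 2 := by gcongr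
      _ = 104 / δ := by field_simp; norm_num
  set g := 2 * (w - s) / a ^ 2
  set u := ‖w - t‖
  have hu : 0 < u := norm_pos_iff.2 hwt
  have hu9 : u / δ ≤ 9 := by
    rw [div_le_iff₀ hδ]
    exact (norm_sub_le _ _).trans (by linarith)
  have hud : u * (1 / δ) ≤ 9 := by simpa [div_eq_mul_inv] using hu9
  have hQ : ‖g + t * g ^ 2 - (w - t)⁻¹‖ ≤ 32552 * (1 / δ) + u⁻¹ := by
    refine (norm_sub_le _ _).trans (add_le_add ((norm_add_le _ _).trans ?_) (norm_inv _).le)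
    rw [norm_mul, norm_pow]
    calc ‖g‖ + ‖t‖ * ‖g‖ ^ 2 ≤ 104 / δ + 3 * δ * (104 / δ) ^ 2 := by gcongr
      _ = 32552 * (1 / δ) := by field_simp; norm_num
  rw [← div_eq_mul_inv, le_div_iff₀ (by positivity)]
  have h3 : 1 + (u / δ) ^ 2 ≤ 82 := by nlinarith [div_pos hu hδ]
  calc ‖g + t * g ^ 2 - (w - t)⁻¹‖ * (u * (1 + (u / δ) ^ 2))
      ≤ (32552 * (1 / δ) + u⁻¹) * (u * 82) := by gcongr
    _ = 82 * (32552 * (u * (1 / δ)) + u⁻¹ * u) := by ring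
    _ ≤ 82 * (32552 * 9 + 1) := by rw [inv_mul_cancel₀ hu.ne']; gcongr
    _ ≤ 3 * 10 ^ 7 := by norm_num

lemma norm_kernel_sub_le_of_far {a w t s : ℂ} {δ : ℝ} (hδ : 0 < δ) (ha : δ / 2 ≤ ‖a‖)
    (ha' : ‖a‖ ≤ δ) (hs : s ^ 2 = w ^ 2 - a ^ 2) (hw : 6 * δ ≤ ‖w‖) (ht : ‖t‖ ≤ 3 * δ)
    (hws : ‖w - s‖ ≤ ‖a‖) :
    ‖2 * (w - s) / a ^ 2 + t * (2 * (w - s) / a ^ 2) ^ 2 - (w - t)⁻¹‖ ≤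
      3 * 10 ^ 7 * (‖w - t‖ * (1 + (‖w - t‖ / δ) ^ 2))⁻¹ := by
  have ha0 : a ≠ 0 := norm_pos_iff.1 (by linarith)
  have hwp : 0 < ‖w‖ := by linarith
  have hw0 : w ≠ 0 := norm_pos_iff.1 hwp
  have hJ : ‖w - s‖ * ‖w‖ ≤ ‖a‖ ^ 2 := by
    have h1 : (w - s) * (w + s) = a ^ 2 := by linear_combination -hs
    have h2 : ‖w‖ ≤ ‖w + s‖ := by
      have := norm_sub_norm_le (2 * w) (w - s)
      rw [norm_mul, RCLike.norm_ofNat, show 2 * w - (w - s) = w + s by ring] at this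
      linarith
    rw [← norm_pow, ← h1, norm_mul]
    gcongr
  have hquad : w * (2 * (w - s) / a ^ 2) - 1 = a ^ 2 / 4 * (2 * (w - s) / a ^ 2) ^ 2 := by
    field_simp
    linear_combination -4 * hs
  have hg : ‖2 * (w - s) / a ^ 2‖ ≤ 2 / ‖w‖ := by
    rw [norm_div, norm_mul, norm_pow, RCLike.norm_ofNat, div_le_div_iff₀ (by positivity) hwp]
    linarith
  set g := 2 * (w - s) / a ^ 2
  have hg1 : ‖g - w⁻¹‖ ≤ δ ^ 2 / ‖w‖ ^ 3 := by
    have h1 : g - w⁻¹ = w⁻¹ * (a ^ 2 / 4 * g ^ 2) := by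
      rw [← hquad]; field_simp
    rw [h1, norm_mul, norm_mul, norm_div, norm_pow, norm_pow, norm_inv, RCLike.norm_ofNat]
    calc ‖w‖⁻¹ * (‖a‖ ^ 2 / 4 * ‖g‖ ^ 2) ≤ ‖w‖⁻¹ * (δ ^ 2 / 4 * (2 / ‖w‖) ^ 2) := by gcongr
      _ = δ ^ 2 / ‖w‖ ^ 3 := by field_simp; norm_num
  have hwt : ‖w‖ / 2 ≤ ‖w - t‖ := by
    linarith [norm_sub_norm_le w t]
  have hu : 0 < ‖w - t‖ := by linarith
  have hwt0 : w - t ≠ 0 := norm_pos_iff.1 hu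
  have hu3 : ‖w - t‖ ≤ 3 / 2 * ‖w‖ := (norm_sub_le _ _).trans (by linarith)
  have hQ : ‖g + t * g ^ 2 - (w - t)⁻¹‖ ≤ 21 * (δ ^ 2 / ‖w‖ ^ 3) := by
    have h1 : g + t * g ^ 2 - (w - t)⁻¹ =
        (g - w⁻¹) + t * ((g - w⁻¹) * (g + w⁻¹)) - t ^ 2 * (w⁻¹ ^ 2 * (w - t)⁻¹) := by
      field_simp
      ring
    have h2 : ‖t * ((g - w⁻¹) * (g + w⁻¹))‖ ≤ 2 * (δ ^ 2 / ‖w‖ ^ 3) := by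
      have h3 : ‖g + w⁻¹‖ ≤ 3 / ‖w‖ := by
        refine (norm_add_le _ _).trans ?_
        rw [norm_inv]
        calc ‖g‖ + ‖w‖⁻¹ ≤ 2 / ‖w‖ + ‖w‖⁻¹ := by gcongr
          _ = 3 / ‖w‖ := by field_simp; norm_num
      rw [norm_mul, norm_mul]
      calc ‖t‖ * (‖g - w⁻¹‖ * ‖g + w⁻¹‖)
          ≤ (3 * δ) * (δ ^ 2 / ‖w‖ ^ 3 * (3 / ‖w‖)) := by gcongr
        _ = (9 * δ / ‖w‖) * (δ ^ 2 / ‖w‖ ^ 3) := by ring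
        _ ≤ 2 * (δ ^ 2 / ‖w‖ ^ 3) := by
            gcongr
            rw [div_le_iff₀ hwp]
            linarith
    have h4 : ‖t ^ 2 * (w⁻¹ ^ 2 * (w - t)⁻¹)‖ ≤ 18 * (δ ^ 2 / ‖w‖ ^ 3) := by
      rw [norm_mul, norm_mul, norm_pow, norm_pow, norm_inv, norm_inv]
      calc ‖t‖ ^ 2 * (‖w‖⁻¹ ^ 2 * ‖w - t‖⁻¹)
          ≤ (3 * δ) ^ 2 * (‖w‖⁻¹ ^ 2 * (‖w‖ / 2)⁻¹) := by gcongr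
        _ = 18 * (δ ^ 2 / ‖w‖ ^ 3) := by field_simp; norm_num
    rw [h1]
    refine (norm_sub_le _ _).trans ?_
    have := norm_add_le (g - w⁻¹) (t * ((g - w⁻¹) * (g + w⁻¹)))
    linarith
  set u := ‖w - t‖
  rw [← div_eq_mul_inv, le_div_iff₀ (by positivity)]
  have hδu : 1 ≤ (u / δ) ^ 2 := by
    have : 1 ≤ u / δ := by rw [le_div_iff₀ hδ]; linarith
    nlinarith
  calc ‖g + t * g ^ 2 - (w - t)⁻¹‖ * (u * (1 + (u / δ) ^ 2))
      ≤ 21 * (δ ^ 2 / ‖w‖ ^ 3) * (u * ((u / δ) ^ 2 + (u / δ) ^ 2)) := by gcongr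
    _ = 42 * (u / ‖w‖) ^ 3 := by field_simp; norm_num
    _ ≤ 42 * (3 / 2) ^ 3 := by
        have : u / ‖w‖ ≤ 3 / 2 := by rwa [div_le_iff₀ hwp]
        gcongr
    _ ≤ 3 * 10 ^ 7 := by norm_num

/-- **Mergelyan's kernel.** On `K`, the Cauchy kernel with pole `ζ` in the disc of centre `x ∉ K` and
radius `2 * δ` is matched to third order by a quadratic expression in a uniform limit of
polynomials. -/
lemma exists_mergelyan_kernel {K : Set ℂ} (hK : IsCompact K) (hconn : IsConnected Kᶜ) {x : ℂ}
    (hx : x ∉ K) {δ : ℝ} (hδ : 0 < δ) :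
    ∃ g ∈ polynomialClosure hK, ∃ m : ℂ, ∀ ζ ∈ Metric.ball x (2 * δ), ∀ z ∈ K, z ≠ ζ →
      ‖g z + (ζ - m) * g z ^ 2 - (z - ζ)⁻¹‖ ≤
        3 * 10 ^ 7 * (‖z - ζ‖ * (1 + (‖z - ζ‖ / δ) ^ 2))⁻¹ := by
  obtain ⟨q, hq, hq', s, hsc, hsm, hs⟩ := exists_sqrtLinked (hK := hK) hconn hx hδ
  set a := (q - x) / 2 with ha_def
  set m := (q + x) / 2 with hm_def
  have ha : ‖a‖ = ‖q - x‖ / 2 := by simp [ha_def]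
  have hmx : ‖m - x‖ = ‖q - x‖ / 2 := by rw [← ha, ha_def, hm_def]; ring_nf
  have ha₁ : δ / 2 ≤ ‖a‖ := by linarith
  have ha₂ : ‖a‖ ≤ δ := by linarith
  have hsq (z : ℂ) (hz : z ∈ K ∪ (Metric.ball x (2 * δ))ᶜ) :
      s z ^ 2 = (z - m) ^ 2 - a ^ 2 := by rw [hs z hz]; ring
  have hout (z : ℂ) (hz : 3 * δ < ‖z - m‖) : z ∈ (Metric.ball x (2 * δ))ᶜ := by
    have := norm_sub_le_norm_sub_add_norm_sub z x m
    rw [norm_sub_rev x m] at this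
    simp only [mem_compl_iff, Metric.mem_ball, dist_eq_norm, not_lt]
    linarith
  -- after a choice of sign, `s` is the branch with `s z ~ z` at infinity
  obtain ⟨σ, hσm, hσsq, hσ⟩ : ∃ σ ∈ polynomialClosure hK,
      (∀ z ∈ K, σ z ^ 2 = (z - m) ^ 2 - a ^ 2) ∧
      ∀ z, 3 * δ < ‖z - m‖ → ‖(z - m) - σ z‖ ≤ ‖a‖ := by
    have hne (σ : ℂ → ℂ) (hσsq : ∀ z ∈ (Metric.ball x (2 * δ))ᶜ, σ z ^ 2 = (z - m) ^ 2 - a ^ 2)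
        (z : ℂ) (hz : 3 * δ < ‖z - m‖) : ‖(z - m) - σ z‖ ≠ ‖a‖ := by
      intro heq
      have h1 : ((z - m) - σ z) * ((z - m) + σ z) = a ^ 2 := by
        linear_combination -hσsq z (hout z hz)
      have h2 : ‖(z - m) + σ z‖ = ‖a‖ := by
        have := congrArg norm h1
        rw [norm_mul, norm_pow, heq, sq] at this
        exact mul_left_cancel₀ (by linarith) this
      have h3 := norm_add_le ((z - m) - σ z) ((z - m) + σ z)
      rw [heq, h2, show (z - m) - σ z + ((z - m) + σ z) = 2 * (z - m) by ring, norm_mul,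
        RCLike.norm_ofNat] at h3
      linarith
    have hall (σ : ℂ → ℂ) (hσc : ContinuousOn σ (K ∪ (Metric.ball x (2 * δ))ᶜ))
        (hσsq : ∀ z ∈ (Metric.ball x (2 * δ))ᶜ, σ z ^ 2 = (z - m) ^ 2 - a ^ 2)
        {z₀ : ℂ} (hz₀ : 3 * δ < ‖z₀ - m‖) (hlt : ‖(z₀ - m) - σ z₀‖ < ‖a‖) :
        ∀ z, 3 * δ < ‖z - m‖ → ‖(z - m) - σ z‖ ≤ ‖a‖ := by
      intro z hz
      by_contra! hgt
      have hpre := isPreconnected_norm_sub_gt m (ρ := 3 * δ) (by positivity)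
      obtain ⟨y, hy, hya⟩ := hpre.intermediate_value (f := fun z => ‖(z - m) - σ z‖) hz₀ hz
        (((by fun_prop : ContinuousOn (fun z => z - m) _).sub
          (hσc.mono fun y hy => Or.inr (hout y hy))).norm) ⟨hlt.le, hgt.le⟩
      exact hne σ hσsq y hy hya
    have hsq' : ∀ z ∈ (Metric.ball x (2 * δ))ᶜ, (-s) z ^ 2 = (z - m) ^ 2 - a ^ 2 := fun z hz => by
      simpa using hsq z (Or.inr hz)
    let z₀ : ℂ := m + (4 * δ : ℝ)
    have hz₀ : 3 * δ < ‖z₀ - m‖ := by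
      simp only [z₀, add_sub_cancel_left, norm_real, Real.norm_eq_abs]
      rw [abs_of_pos (by positivity)]
      linarith
    rcases lt_or_ge ‖(z₀ - m) - s z₀‖ ‖a‖ with h | h
    · exact ⟨s, hsm, fun z hz => hsq z (Or.inl hz),
        hall s hsc (fun z hz => hsq z (Or.inr hz)) hz₀ h⟩
    · refine ⟨-s, Subalgebra.neg_mem _ hsm, fun z hz => by simpa using hsq z (Or.inl hz),
        hall (-s) hsc.neg hsq' hz₀ ?_⟩
      have hprod : ‖(z₀ - m) - s z₀‖ * ‖(z₀ - m) - (-s) z₀‖ = ‖a‖ ^ 2 := by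
        rw [← norm_mul, ← norm_pow, Pi.neg_apply]
        congr 1
        linear_combination -hsq z₀ (Or.inr (hout z₀ hz₀))
      refine lt_of_le_of_ne ?_ (hne (-s) hsq' z₀ hz₀)
      by_contra! h'
      have hap : 0 < ‖a‖ := by linarith
      nlinarith
  refine ⟨fun z => 2 * ((z - m) - σ z) / a ^ 2, ?_, m, fun ζ hζ z hz hne => ?_⟩
  · have : (fun z => 2 * ((z - m) - σ z) / a ^ 2) = (2 / a ^ 2) • ((fun z => z - m) - σ) := by
      ext z
      simp only [Pi.smul_apply, Pi.sub_apply, smul_eq_mul]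
      ring
    rw [this]
    exact Subalgebra.smul_mem _
      (Subalgebra.sub_mem _ (sub_const_mem_polynomialClosure hK m) hσm) _
  · have ht : ‖ζ - m‖ ≤ 3 * δ := by
      have := norm_sub_le_norm_sub_add_norm_sub ζ x m
      rw [norm_sub_rev x m] at this
      rw [Metric.mem_ball, dist_eq_norm] at hζ
      linarith
    have hzζ : z - ζ = (z - m) - (ζ - m) := by ring
    rw [hzζ]
    rcases le_total ‖z - m‖ (6 * δ) with hw | hw
    · exact norm_kernel_sub_le_of_near hδ ha₁ ha₂ (hσsq z hz) hw ht
        (by rw [← hzζ]; exact sub_ne_zero.2 hne)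
    · exact norm_kernel_sub_le_of_far hδ ha₁ ha₂ (hσsq z hz) hw ht (hσ z (by linarith))

open MeasureTheory

/-- The integrable majorant of the error made when the Cauchy kernel is replaced by Mergelyan's
kernel at scale `δ`. -/
noncomputable def kernelBound (δ : ℝ) (u : ℂ) : ℝ := (‖u‖ * (1 + (‖u‖ / δ) ^ 2))⁻¹

lemma kernelBound_nonneg (δ : ℝ) (u : ℂ) : 0 ≤ kernelBound δ u := by
  unfold kernelBound; positivity

lemma integrable_kernelBound {δ : ℝ} (hδ : 0 < δ) : Integrable (kernelBound δ) := by
  unfold kernelBound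
  rw [integrable_fun_norm_addHaar volume (f := fun y : ℝ => (y * (1 + (y / δ) ^ 2))⁻¹),
    finrank_real_complex]
  have h := (integrable_inv_one_add_sq.comp_div hδ.ne').integrableOn (s := Ioi 0)
  refine h.congr_fun (fun y hy => ?_) measurableSet_Ioi
  have : y ≠ 0 := (mem_Ioi.1 hy).ne'
  simp only [smul_eq_mul]
  field_simp
  simp

lemma integral_kernelBound {δ : ℝ} (hδ : 0 < δ) :
    ∫ u, kernelBound δ u = Real.pi ^ 2 * δ := by
  unfold kernelBound
  rw [integral_fun_norm_addHaar volume (f := fun y : ℝ => (y * (1 + (y / δ) ^ 2))⁻¹),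
    finrank_real_complex]
  have h : ∫ y in Ioi (0 : ℝ), y ^ (2 - 1) • (y * (1 + (y / δ) ^ 2))⁻¹ =
      ∫ y in Ioi (0 : ℝ), (1 + (δ⁻¹ * y) ^ 2)⁻¹ := by
    refine setIntegral_congr_fun measurableSet_Ioi fun y hy => ?_
    have : y ≠ 0 := (mem_Ioi.1 hy).ne'
    simp only [smul_eq_mul]
    field_simp
    simp
  rw [h, integral_comp_mul_left_Ioi (fun y => (1 + y ^ 2)⁻¹) 0 (inv_pos.2 hδ), mul_zero,
    integral_Ioi_inv_one_add_sq]
  simp [Measure.real]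
  ring

lemma integral_kernelBound_sub {δ : ℝ} (hδ : 0 < δ) (z : ℂ) :
    ∫ ζ, kernelBound δ (z - ζ) = Real.pi ^ 2 * δ := by
  rw [integral_sub_left_eq_self (kernelBound δ) volume z, integral_kernelBound hδ]

lemma integrable_of_bounded_of_support {ψ : ℂ → ℂ} (hm : Measurable ψ) {M R : ℝ}
    (hb : ∀ ζ, ‖ψ ζ‖ ≤ M) (hR : ∀ ζ, R ≤ ‖ζ‖ → ψ ζ = 0) : Integrable ψ := by
  refine Integrable.mono' (g := (Metric.ball 0 R).indicator fun _ => M)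
    ((integrable_indicator_iff measurableSet_ball).2
      (integrableOn_const measure_ball_lt_top.ne))
    hm.aestronglyMeasurable (.of_forall fun ζ => ?_)
  by_cases h : ζ ∈ Metric.ball (0 : ℂ) R
  · simpa [h] using hb ζ
  · rw [indicator_of_notMem h, hR ζ (by simpa using h), norm_zero]

lemma integrable_mul_inv_sub {ψ : ℂ → ℂ} (hm : Measurable ψ) {M R : ℝ}
    (hb : ∀ ζ, ‖ψ ζ‖ ≤ M) (hR : ∀ ζ, R ≤ ‖ζ‖ → ψ ζ = 0) (z : ℂ) :
    Integrable fun ζ => ψ ζ * (z - ζ)⁻¹ := by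
  refine Integrable.mono' (((integrable_kernelBound one_pos).comp_sub_left z).const_mul
    (M * (1 + (‖z‖ + R) ^ 2))) (by fun_prop) (.of_forall fun ζ => ?_)
  rcases le_or_gt R ‖ζ‖ with h | h
  · have hM : 0 ≤ M := (norm_nonneg _).trans (hb 0)
    have := kernelBound_nonneg 1 (z - ζ)
    simp only [hR ζ h, zero_mul, norm_zero]
    positivity
  · rw [norm_mul, norm_inv, kernelBound, mul_inv, div_one]
    have hn : ‖z - ζ‖ ≤ ‖z‖ + R := (norm_sub_le _ _).trans (by linarith)
    have h1 : 1 ≤ (1 + (‖z‖ + R) ^ 2) * (1 + ‖z - ζ‖ ^ 2)⁻¹ := by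
      rw [← div_eq_mul_inv, one_le_div (by positivity)]
      gcongr
    calc ‖ψ ζ‖ * ‖z - ζ‖⁻¹ ≤ M * ‖z - ζ‖⁻¹ := by gcongr; exact hb ζ
      _ ≤ M * ‖z - ζ‖⁻¹ * ((1 + (‖z‖ + R) ^ 2) * (1 + ‖z - ζ‖ ^ 2)⁻¹) :=
          le_mul_of_one_le_right (mul_nonneg ((norm_nonneg _).trans (hb 0)) (by positivity)) h1
      _ = _ := by ring

/-- An integral over the plane as an average over rotations. -/
lemma two_pi_mul_integral_eq {h : ℂ → ℂ} (hm : Measurable h) (hi : Integrable h) :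
    2 * Real.pi * ∫ u, h u = ∫ u, ∫ θ in (0 : ℝ)..2 * Real.pi, h (exp (θ * I) * u) := by
  have hrot (θ : ℝ) : MeasurePreserving (fun u : ℂ => exp (θ * I) * u) := by
    convert (rotation (Circle.exp θ)).measurePreserving using 1
    ext u
    simp
  have hemb (θ : ℝ) : MeasurableEmbedding (fun u : ℂ => exp (θ * I) * u) :=
    measurableEmbedding_mulLeft₀ (exp_ne_zero _)
  have hintegrable : Integrable (Function.uncurry fun (u : ℂ) (θ : ℝ) => h (exp (θ * I) * u))
      (volume.prod (volume.restrict (Ioc 0 (2 * Real.pi)))) := by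
    refine (integrable_prod_iff' (hm.comp (by fun_prop)).aestronglyMeasurable).2 ⟨.of_forall fun θ => ?_, ?_⟩
    · exact (hrot θ).integrable_comp_of_integrable hi
    · have (θ : ℝ) : ∫ u, ‖h (exp (θ * I) * u)‖ = ∫ u, ‖h u‖ :=
        (hrot θ).integral_comp (hemb θ) fun u => ‖h u‖
      exact (integrable_const (∫ u, ‖h u‖)).congr (.of_forall fun θ => (this θ).symm)
  simp only [intervalIntegral.integral_of_le Real.two_pi_pos.le]
  rw [integral_integral_swap hintegrable]
  have (θ : ℝ) : ∫ u, h (exp (θ * I) * u) = ∫ u, h u := (hrot θ).integral_comp (hemb θ) h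
  simp [this, Real.pi_pos.le]

lemma integral_exp_mul_eq_circleIntegral (G : ℂ → ℂ) :
    ∫ θ in (0 : ℝ)..2 * Real.pi, exp (θ * I) * G (exp (θ * I)) = -I * ∮ v in C(0, 1), G v := by
  simp only [circleIntegral, deriv_circleMap, circleMap, smul_eq_mul, ofReal_one, one_mul, zero_add]
  rw [← intervalIntegral.integral_const_mul]
  congr 1 with θ
  linear_combination (exp (θ * I) * G (exp (θ * I))) * I_mul_I

lemma integral_ball_mul_eq_zero {f : ℂ → ℂ} (hf : Continuous f) {ζ : ℂ} {δ : ℝ}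
    (hd : DifferentiableOn ℂ f (Metric.ball ζ δ)) :
    ∫ η in Metric.ball 0 δ, f (ζ + η) * η = 0 := by
  rw [← integral_indicator measurableSet_ball]
  have hm : Measurable ((Metric.ball 0 δ).indicator fun η => f (ζ + η) * η) :=
    Measurable.indicator (by fun_prop) measurableSet_ball
  have hi : Integrable ((Metric.ball 0 δ).indicator fun η => f (ζ + η) * η) := by
    rw [integrable_indicator_iff measurableSet_ball]
    exact ((by fun_prop : Continuous fun η => f (ζ + η) * η).continuousOn.integrableOn_compact
      (isCompact_closedBall 0 δ)).mono_set Metric.ball_subset_closedBall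
  have h := two_pi_mul_integral_eq hm hi
  have hinner (u : ℂ) : ∫ θ in (0 : ℝ)..2 * Real.pi,
      (Metric.ball 0 δ).indicator (fun η => f (ζ + η) * η) (exp (θ * I) * u) = 0 := by
    by_cases hu : ‖u‖ < δ
    · have (θ : ℝ) : (Metric.ball 0 δ).indicator (fun η => f (ζ + η) * η) (exp (θ * I) * u)
          = u * (exp (θ * I) * f (ζ + exp (θ * I) * u)) := by
        rw [indicator_of_mem (by simpa [norm_exp_ofReal_mul_I] using hu)]
        ring
      simp only [this]
      rw [intervalIntegral.integral_const_mul,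
        integral_exp_mul_eq_circleIntegral fun v => f (ζ + v * u),
        Complex.circleIntegral_eq_zero_of_differentiable_on_off_countable zero_le_one
          countable_empty, mul_zero, mul_zero]
      · fun_prop
      · intro v hv
        have hmem : ζ + v * u ∈ Metric.ball ζ δ := by
          have h1 : ‖v‖ < 1 := by simpa using hv.1
          have : ‖v‖ * ‖u‖ < δ := by nlinarith [norm_nonneg u, norm_nonneg v]
          simpa [dist_eq_norm] using this
        exact (hd.differentiableAt (Metric.isOpen_ball.mem_nhds hmem)).comp v (by fun_prop)
    · have (θ : ℝ) : (Metric.ball 0 δ).indicator (fun η => f (ζ + η) * η) (exp (θ * I) * u) = 0 :=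
        indicator_of_notMem (by simpa [norm_exp_ofReal_mul_I] using hu) _
      simp [this]
  simp only [hinner, integral_zero] at h
  simpa [Real.pi_ne_zero] using h

lemma integral_ball_mul_inv_sub {δ : ℝ} (hδ : 0 < δ) (z : ℂ) :
    ∫ v, (Metric.ball 0 δ).indicator (fun v => v) v * (z - v)⁻¹ =
      -(Real.pi * (max 0 (δ ^ 2 - ‖z‖ ^ 2) : ℝ)) := by
  have hm : Measurable ((Metric.ball (0 : ℂ) δ).indicator fun v => v) :=
    measurable_id.indicator measurableSet_ball
  have hi : Integrable fun v => (Metric.ball 0 δ).indicator (fun v => v) v * (z - v)⁻¹ := by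
    refine integrable_mul_inv_sub hm (M := δ) (R := δ) (fun ζ => ?_) (fun ζ hζ => ?_) z
    · by_cases h : ‖ζ‖ < δ
      · rw [indicator_of_mem (by simpa using h)]; exact h.le
      · rw [indicator_of_notMem (by simpa using h), norm_zero]; exact hδ.le
    · exact indicator_of_notMem (by simpa using hζ) _
  have h := two_pi_mul_integral_eq (by fun_prop) hi
  have hinner : ∀ᵐ u : ℂ, ∫ θ in (0 : ℝ)..2 * Real.pi,
      (Metric.ball 0 δ).indicator (fun v => v) (exp (θ * I) * u) * (z - exp (θ * I) * u)⁻¹ =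
      (Metric.ball 0 δ \ Metric.closedBall 0 ‖z‖).indicator (fun _ => (-(2 * Real.pi) : ℂ)) u := by
    have hs : ∀ᵐ u : ℂ, u ∉ Metric.sphere (0 : ℂ) ‖z‖ :=
      measure_eq_zero_iff_ae_notMem.1 (Measure.addHaar_sphere volume 0 ‖z‖)
    have h0 : ∀ᵐ u : ℂ, u ∉ ({0} : Set ℂ) := measure_eq_zero_iff_ae_notMem.1 (by simp)
    filter_upwards [hs, h0] with u hu hu0
    replace hu0 : u ≠ 0 := hu0
    have hup : 0 < ‖u‖ := norm_pos_iff.2 hu0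
    by_cases huδ : ‖u‖ < δ
    · have (θ : ℝ) : (Metric.ball 0 δ).indicator (fun v => v) (exp (θ * I) * u) *
          (z - exp (θ * I) * u)⁻¹ = exp (θ * I) * -(exp (θ * I) - z / u)⁻¹ := by
        rw [indicator_of_mem (by simpa [norm_exp_ofReal_mul_I] using huδ),
          show z - exp (θ * I) * u = -(exp (θ * I) - z / u) * u by field_simp; ring, mul_inv,
          inv_neg]
        field_simp
      simp only [this]
      rw [integral_exp_mul_eq_circleIntegral fun v => -(v - z / u)⁻¹]
      rcases lt_or_gt_of_ne (show ‖u‖ ≠ ‖z‖ by simpa using hu) with hlt | hgt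
      · rw [indicator_of_notMem (by simp [hlt.le]),
          Complex.circleIntegral_eq_zero_of_differentiable_on_off_countable zero_le_one
          countable_empty, mul_zero]
        all_goals
          have hz : 1 < ‖z / u‖ := by rwa [norm_div, one_lt_div hup]
          have hne (v : ℂ) (hv : ‖v‖ ≤ 1) : v - z / u ≠ 0 := by
            refine sub_ne_zero.2 fun h => ?_
            rw [h] at hv
            linarith
        · exact (ContinuousOn.inv₀ (by fun_prop) fun v hv => hne v (by simpa using hv)).neg
        · intro v hv
          have : ‖v‖ < 1 := by simpa using hv
          exact ((by fun_prop : DifferentiableAt ℂ (fun v => v - z / u) v).inv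
            (hne v this.le)).neg
      · rw [indicator_of_mem (by simp [hgt, huδ])]
        have hz : z / u ∈ Metric.ball (0 : ℂ) 1 := by
          rw [mem_ball_zero_iff, norm_div, div_lt_one hup]
          exact hgt
        have hc : ∮ v in C(0, 1), -(v - z / u)⁻¹ = -(2 * Real.pi * I) := by
          rw [← circleIntegral.integral_sub_inv_of_mem_ball hz]
          simp [circleIntegral]
        rw [hc]
        linear_combination (2 * Real.pi) * I_mul_I
    · simp [huδ]
  rw [integral_congr_ae hinner, integral_indicator (measurableSet_ball.diff measurableSet_closedBall),
    setIntegral_const] at h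
  have hvol : volume.real (Metric.ball (0 : ℂ) δ \ Metric.closedBall 0 ‖z‖) =
      Real.pi * max 0 (δ ^ 2 - ‖z‖ ^ 2) := by
    rcases lt_or_ge ‖z‖ δ with hz | hz
    · rw [measureReal_sdiff (Metric.closedBall_subset_ball hz) measurableSet_closedBall
        measure_ball_lt_top.ne, max_eq_right (by nlinarith [norm_nonneg z])]
      simp [Measure.real, hδ.le]
      ring
    · rw [sdiff_eq_empty.2 ((Metric.ball_subset_ball hz).trans Metric.ball_subset_closedBall),
        max_eq_left (by nlinarith [norm_nonneg z])]
      simp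
  rw [hvol] at h
  have hπ : (2 * Real.pi : ℂ) ≠ 0 := by simp [Real.pi_ne_zero]
  refine mul_left_cancel₀ hπ (h.trans ?_)
  rw [real_smul]
  push_cast
  ring

/-- Up to a factor, `ballMoment f δ` is the `∂̄`-derivative of the average of `f` against
`max 0 (δ ^ 2 - ‖u‖ ^ 2)`. -/
noncomputable def ballMoment (f : ℂ → ℂ) (δ : ℝ) (ζ : ℂ) : ℂ :=
  ∫ η in Metric.ball 0 δ, f (ζ + η) * η

section ballMoment

variable {f : ℂ → ℂ} {δ : ℝ}

lemma measurable_ballMoment (hf : Continuous f) : Measurable (ballMoment f δ) := by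
  have : Continuous fun p : ℂ × ℂ => f (p.1 + p.2) * p.2 := by fun_prop
  exact (this.stronglyMeasurable.integral_prod_right'
    (ν := volume.restrict (Metric.ball 0 δ))).measurable

lemma norm_ballMoment_le (hf : Continuous f) (hδ : 0 < δ) {ω : ℝ}
    (hω : ∀ x y, ‖x - y‖ < δ → ‖f x - f y‖ ≤ ω) (ζ : ℂ) :
    ‖ballMoment f δ ζ‖ ≤ ω * δ * (Real.pi * δ ^ 2) := by
  have hintegrable (F : ℂ → ℂ) (hF : Continuous F) : IntegrableOn F (Metric.ball 0 δ) :=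
    (hF.continuousOn.integrableOn_compact (isCompact_closedBall 0 δ)).mono_set
      Metric.ball_subset_closedBall
  have h0 : ∫ η in Metric.ball 0 δ, f ζ * η = 0 :=
    integral_ball_mul_eq_zero (f := fun _ => f ζ) continuous_const (ζ := ζ)
      (differentiableOn_const _)
  have h1 : ballMoment f δ ζ = ∫ η in Metric.ball 0 δ, (f (ζ + η) - f ζ) * η := by
    simp only [sub_mul]
    rw [integral_sub (hintegrable _ (by fun_prop)) (hintegrable _ (by fun_prop)), h0, sub_zero, ballMoment]
  rw [h1]
  have h2 := norm_setIntegral_le_of_norm_le_const (μ := volume) (s := Metric.ball (0 : ℂ) δ)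
    (f := fun η => (f (ζ + η) - f ζ) * η) (C := ω * δ) measure_ball_lt_top fun η hη => by
      have hη' : ‖η‖ < δ := by simpa using hη
      have := hω (ζ + η) ζ (by simpa using hη')
      rw [norm_mul]
      have hω0 : 0 ≤ ω := (norm_nonneg _).trans this
      gcongr
  have hv : volume.real (Metric.ball (0 : ℂ) δ) = Real.pi * δ ^ 2 := by
    simp [Measure.real, hδ.le]
    ring
  rwa [hv] at h2

lemma ballMoment_eq_zero_of_support {R : ℝ} (hR : ∀ z, R ≤ ‖z‖ → f z = 0) (ζ : ℂ)
    (hζ : R + δ ≤ ‖ζ‖) : ballMoment f δ ζ = 0 := by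
  refine setIntegral_eq_zero_of_forall_eq_zero fun η hη => ?_
  have hη' : ‖η‖ < δ := by simpa using hη
  rw [hR _, zero_mul]
  have := norm_sub_norm_le ζ (-η)
  rw [norm_neg, sub_neg_eq_add] at this
  linarith

lemma integral_ballMoment_mul_inv_sub (hf : Continuous f) (hδ : 0 < δ) {M R : ℝ}
    (hM : ∀ z, ‖f z‖ ≤ M) (hR : ∀ z, R ≤ ‖z‖ → f z = 0) (z : ℂ) :
    ∫ ζ, ballMoment f δ ζ * (z - ζ)⁻¹ =
      Real.pi * ∫ u, f (z + u) * (max 0 (δ ^ 2 - ‖u‖ ^ 2) : ℝ) := by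
  let b : ℂ → ℂ := (Metric.ball 0 δ).indicator fun v => v
  have hbm : Measurable b := measurable_id.indicator measurableSet_ball
  have hbδ (v : ℂ) : ‖b v‖ ≤ δ := by
    by_cases h : ‖v‖ < δ
    · simp only [b]; rw [indicator_of_mem (by simpa using h)]; exact h.le
    · simp only [b]; rw [indicator_of_notMem (by simpa using h), norm_zero]; exact hδ.le
  have hb0 (v : ℂ) (hv : δ ≤ ‖v‖) : b v = 0 := indicator_of_notMem (by simpa using hv) _
  have hmom (ζ : ℂ) : ballMoment f δ ζ * (z - ζ)⁻¹ = ∫ y, f y * b (y - ζ) * (z - ζ)⁻¹ := by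
    rw [integral_mul_const, ballMoment, ← integral_indicator measurableSet_ball,
      ← integral_add_left_eq_self (fun y => f y * b (y - ζ)) ζ]
    congr 2
    ext η
    by_cases h : η ∈ Metric.ball (0 : ℂ) δ <;> simp [b, h]
  have hintegrable : Integrable (Function.uncurry fun ζ y : ℂ => f y * b (y - ζ) * (z - ζ)⁻¹)
      (volume.prod volume) := by
    have h1 : Integrable fun ζ : ℂ =>
        (Metric.ball (0 : ℂ) (R + δ)).indicator (fun _ => (δ : ℂ)) ζ * (z - ζ)⁻¹ := by
      refine integrable_mul_inv_sub (measurable_const.indicator measurableSet_ball) (M := δ)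
        (R := R + δ) (fun ζ => ?_) (fun ζ hζ => indicator_of_notMem (by simpa using hζ) _) z
      refine (norm_indicator_le_norm_self _ _).trans ?_
      simp [abs_of_pos hδ]
    have h2 : Integrable f := integrable_of_bounded_of_support hf.measurable hM hR
    refine (h1.mul_prod h2).mono ?_ (.of_forall fun ⟨ζ, y⟩ => ?_)
    · have h3 : Measurable fun p : ℂ × ℂ => b (p.2 - p.1) := hbm.comp (by fun_prop)
      have h4 : Measurable fun p : ℂ × ℂ => f p.2 := hf.measurable.comp measurable_snd
      exact ((h4.mul h3).mul (by fun_prop)).aestronglyMeasurable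
    · simp only [Function.uncurry_apply_pair, norm_mul]
      by_cases hy : R ≤ ‖y‖
      · simp [hR y hy]
      have hle : ‖b (y - ζ)‖ ≤
          ‖(Metric.ball (0 : ℂ) (R + δ)).indicator (fun _ => (δ : ℂ)) ζ‖ := by
        by_cases hζ : ‖ζ‖ < R + δ
        · rw [indicator_of_mem (by simpa using hζ)]
          simpa [abs_of_pos hδ] using hbδ _
        · have : δ ≤ ‖y - ζ‖ := by
            have := norm_sub_norm_le ζ y
            rw [norm_sub_rev] at this
            linarith
          rw [hb0 _ this, norm_zero]
          positivity
      calc ‖f y‖ * ‖b (y - ζ)‖ * ‖(z - ζ)⁻¹‖ = ‖b (y - ζ)‖ * (‖(z - ζ)⁻¹‖ * ‖f y‖) := by ring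
        _ ≤ _ := mul_le_mul_of_nonneg_right hle (by positivity)
        _ = _ := by ring
  have hinner (y : ℂ) : ∫ ζ, f y * b (y - ζ) * (z - ζ)⁻¹ =
      Real.pi * (f y * (max 0 (δ ^ 2 - ‖y - z‖ ^ 2) : ℝ)) := by
    simp only [mul_assoc]
    rw [integral_const_mul, ← integral_sub_left_eq_self _ volume y]
    have (v : ℂ) : b (y - (y - v)) * (z - (y - v))⁻¹ = -(b v * ((y - z) - v)⁻¹) := by
      rw [sub_sub_cancel, show z - (y - v) = -((y - z) - v) by ring, inv_neg, mul_neg]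
    simp only [this]
    rw [integral_neg, integral_ball_mul_inv_sub hδ]
    ring
  simp only [hmom]
  rw [integral_integral_swap hintegrable]
  simp only [hinner]
  rw [integral_const_mul, ← integral_add_left_eq_self _ z]
  simp

lemma integral_max_sub_norm_sq (hδ : 0 < δ) :
    ∫ u : ℂ, max 0 (δ ^ 2 - ‖u‖ ^ 2) = Real.pi * δ ^ 4 / 2 := by
  rw [integral_fun_norm_addHaar volume (f := fun y : ℝ => max 0 (δ ^ 2 - y ^ 2)),
    finrank_real_complex]
  have h : ∫ y in Ioi (0 : ℝ), y ^ (2 - 1) • max 0 (δ ^ 2 - y ^ 2) =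
      ∫ y in (0 : ℝ)..δ, (δ ^ 2 * y - y ^ 3) := by
    rw [intervalIntegral.integral_of_le hδ.le, ← integral_indicator measurableSet_Ioi,
      ← integral_indicator measurableSet_Ioc]
    congr 1 with y
    by_cases h0 : 0 < y
    · by_cases h1 : y ≤ δ
      · rw [indicator_of_mem (mem_Ioi.2 h0), indicator_of_mem (mem_Ioc.2 ⟨h0, h1⟩),
          max_eq_right (by nlinarith), smul_eq_mul]
        ring
      · rw [indicator_of_mem (mem_Ioi.2 h0), indicator_of_notMem (by simp [h1]),
          max_eq_left (by nlinarith), smul_zero]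
    · rw [indicator_of_notMem (by simpa using h0), indicator_of_notMem (by simp [h0])]
  have h2 : ∫ y in (0 : ℝ)..δ, (δ ^ 2 * y - y ^ 3) = δ ^ 4 / 4 := by
    rw [intervalIntegral.integral_sub (Continuous.intervalIntegrable (by fun_prop) _ _)
      (Continuous.intervalIntegrable (by fun_prop) _ _), intervalIntegral.integral_const_mul,
      integral_id, integral_pow]
    norm_num
    ring
  rw [h, h2]
  simp [Measure.real]
  ring

lemma norm_integral_mul_max_sub_le (hf : Continuous f) (hδ : 0 < δ) {ω : ℝ}
    (hω : ∀ x y, ‖x - y‖ < δ → ‖f x - f y‖ ≤ ω) (z : ℂ) :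
    ‖(∫ u, f (z + u) * (max 0 (δ ^ 2 - ‖u‖ ^ 2) : ℝ)) - (Real.pi * δ ^ 4 / 2 : ℝ) * f z‖ ≤
      ω * (Real.pi * δ ^ 4 / 2) := by
  have hsupp : HasCompactSupport fun u : ℂ => max 0 (δ ^ 2 - ‖u‖ ^ 2) := by
    refine HasCompactSupport.intro (isCompact_closedBall 0 δ) fun u hu => ?_
    have : δ < ‖u‖ := by simpa using hu
    exact max_eq_left (by nlinarith)
  have hcont : Continuous fun u : ℂ => max 0 (δ ^ 2 - ‖u‖ ^ 2) := by fun_prop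
  have hintegrable (F : ℂ → ℂ) (hF : Continuous F) :
      Integrable fun u => F u * (max 0 (δ ^ 2 - ‖u‖ ^ 2) : ℝ) := by
    refine Continuous.integrable_of_hasCompactSupport (by fun_prop) ?_
    exact HasCompactSupport.mul_left (hsupp.comp_left (g := fun x : ℝ => (x : ℂ)) (by simp))
  have h1 : (Real.pi * δ ^ 4 / 2 : ℝ) * f z =
      ∫ u : ℂ, f z * (max 0 (δ ^ 2 - ‖u‖ ^ 2) : ℝ) := by
    rw [integral_const_mul, integral_complex_ofReal, integral_max_sub_norm_sq hδ, mul_comm]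
  rw [h1, ← integral_sub (hintegrable _ (by fun_prop)) (hintegrable _ continuous_const),
    ← integral_max_sub_norm_sq hδ, ← integral_const_mul]
  refine norm_integral_le_of_norm_le
    ((hcont.integrable_of_hasCompactSupport hsupp).const_mul ω) (.of_forall fun u => ?_)
  rw [← sub_mul, norm_mul, norm_real, Real.norm_eq_abs, abs_of_nonneg (le_max_left _ _)]
  rcases lt_or_ge ‖u‖ δ with hu | hu
  · gcongr
    exact hω _ _ (by simpa using hu)
  · rw [max_eq_left (by nlinarith), mul_zero, mul_zero]

end ballMoment

/-- The Cauchy transform of a density which lives on discs of radius `2 * δ` centred off `K` is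
close on `K` to a uniform limit of polynomials. -/
lemma exists_near_cauchyTransform {K : Set ℂ} (hK : IsCompact K) (hconn : IsConnected Kᶜ)
    {δ : ℝ} (hδ : 0 < δ) (T : Finset ℂ) (hT : ∀ x ∈ T, x ∉ K) {M R : ℝ} :
    ∀ ψ : ℂ → ℂ, Measurable ψ → (∀ ζ, ‖ψ ζ‖ ≤ M) → (∀ ζ, R ≤ ‖ζ‖ → ψ ζ = 0) →
      (∀ ζ, ψ ζ ≠ 0 → ∃ x ∈ T, ζ ∈ Metric.ball x (2 * δ)) →
      ∃ F ∈ polynomialClosure hK, ∀ z ∈ K, ‖F z - ∫ ζ, ψ ζ * (z - ζ)⁻¹‖ ≤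
        3 * 10 ^ 7 * ∫ ζ, ‖ψ ζ‖ * kernelBound δ (z - ζ) := by
  induction T using Finset.induction_on with
  | empty =>
    intro ψ _ _ _ hψ
    have h0 : ψ = 0 := by
      ext ζ
      by_contra h
      simpa using hψ ζ h
    exact ⟨0, Subalgebra.zero_mem _, by simp [h0]⟩
  | insert x T hxT ih =>
    intro ψ hm hb hR hψ
    have hM : 0 ≤ M := (norm_nonneg _).trans (hb 0)
    let D := Metric.ball x (2 * δ)
    have hD : MeasurableSet D := measurableSet_ball
    let ψ₁ := D.indicator ψ
    let ψ₂ := Dᶜ.indicator ψ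
    have hsum (ζ : ℂ) : ψ ζ = ψ₁ ζ + ψ₂ ζ := (congrFun (indicator_self_add_compl D ψ) ζ).symm
    have hm₁ : Measurable ψ₁ := hm.indicator hD
    have hm₂ : Measurable ψ₂ := hm.indicator hD.compl
    have hb₁ (ζ : ℂ) : ‖ψ₁ ζ‖ ≤ M := (norm_indicator_le_norm_self _ _).trans (hb ζ)
    have hb₂ (ζ : ℂ) : ‖ψ₂ ζ‖ ≤ M := (norm_indicator_le_norm_self _ _).trans (hb ζ)
    have hR₁ (ζ : ℂ) (h : R ≤ ‖ζ‖) : ψ₁ ζ = 0 := indicator_apply_eq_zero.2 fun _ => hR ζ h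
    have hR₂ (ζ : ℂ) (h : R ≤ ‖ζ‖) : ψ₂ ζ = 0 := indicator_apply_eq_zero.2 fun _ => hR ζ h
    have hk (φ : ℂ → ℂ) (hφ : Measurable φ) (hφM : ∀ ζ, ‖φ ζ‖ ≤ M) (z : ℂ) :
        Integrable fun ζ => ‖φ ζ‖ * kernelBound δ (z - ζ) :=
      ((integrable_kernelBound hδ).comp_sub_left z).bdd_mul (c := M)
        hφ.norm.aestronglyMeasurable (.of_forall fun ζ => by simpa using hφM ζ)
    obtain ⟨F, hF, hFz⟩ := ih (fun y hy => hT y (Finset.mem_insert_of_mem hy)) ψ₂ hm₂ hb₂ hR₂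
      fun ζ hζ => by
        have hζD : ζ ∉ D := fun h => hζ (indicator_of_notMem (by simpa using h) _)
        have hζ0 : ψ ζ ≠ 0 := fun h => hζ (indicator_apply_eq_zero.2 fun _ => h)
        obtain ⟨y, hy, hζy⟩ := hψ ζ hζ0
        rcases Finset.mem_insert.1 hy with rfl | hy
        · exact absurd hζy hζD
        · exact ⟨y, hy, hζy⟩
    obtain ⟨g, hg, m, hgm⟩ :=
      exists_mergelyan_kernel hK hconn (hT x (Finset.mem_insert_self x T)) hδ
    have hi₁ : Integrable ψ₁ := integrable_of_bounded_of_support hm₁ hb₁ hR₁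
    have hi₁m : Integrable fun ζ => ψ₁ ζ * (ζ - m) := by
      refine integrable_of_bounded_of_support (by fun_prop) (M := M * (|R| + ‖m‖)) (R := R)
        (fun ζ => ?_) fun ζ h => by rw [hR₁ ζ h, zero_mul]
      rcases le_or_gt R ‖ζ‖ with h | h
      · rw [hR₁ ζ h, zero_mul, norm_zero]; positivity
      · rw [norm_mul]
        gcongr
        · exact hb₁ ζ
        · exact (norm_sub_le _ _).trans (by gcongr; exact h.le.trans (le_abs_self R))
    let α := ∫ ζ, ψ₁ ζ
    let β := ∫ ζ, ψ₁ ζ * (ζ - m)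
    refine ⟨F + (α • g + β • g ^ 2), Subalgebra.add_mem _ hF (Subalgebra.add_mem _
      (Subalgebra.smul_mem _ hg _) (Subalgebra.smul_mem _ (Subalgebra.pow_mem _ hg 2) _)),
      fun z hz => ?_⟩
    have hi₁z := integrable_mul_inv_sub hm₁ hb₁ hR₁ z
    have hi₂z := integrable_mul_inv_sub hm₂ hb₂ hR₂ z
    have hsplit : ∫ ζ, ψ ζ * (z - ζ)⁻¹ =
        (∫ ζ, ψ₁ ζ * (z - ζ)⁻¹) + ∫ ζ, ψ₂ ζ * (z - ζ)⁻¹ := by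
      rw [← integral_add hi₁z hi₂z]
      simp only [hsum, add_mul]
    have hnsplit : ∫ ζ, ‖ψ ζ‖ * kernelBound δ (z - ζ) =
        (∫ ζ, ‖ψ₁ ζ‖ * kernelBound δ (z - ζ)) + ∫ ζ, ‖ψ₂ ζ‖ * kernelBound δ (z - ζ) := by
      rw [← integral_add (hk _ hm₁ hb₁ z) (hk _ hm₂ hb₂ z)]
      congr 1 with ζ
      by_cases h : ζ ∈ D <;> simp [ψ₁, ψ₂, h]
    have hquad : α * g z + β * g z ^ 2 - ∫ ζ, ψ₁ ζ * (z - ζ)⁻¹ =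
        ∫ ζ, ψ₁ ζ * (g z + (ζ - m) * g z ^ 2 - (z - ζ)⁻¹) := by
      have hadd : Integrable fun ζ => ψ₁ ζ * g z + ψ₁ ζ * (ζ - m) * g z ^ 2 :=
        (hi₁.mul_const _).add (hi₁m.mul_const _)
      simp only [α, β]
      rw [← integral_mul_const, ← integral_mul_const,
        ← integral_add (hi₁.mul_const _) (hi₁m.mul_const _),
        ← integral_sub hadd hi₁z]
      congr 1 with ζ
      ring
    have hbound : ‖∫ ζ, ψ₁ ζ * (g z + (ζ - m) * g z ^ 2 - (z - ζ)⁻¹)‖ ≤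
        3 * 10 ^ 7 * ∫ ζ, ‖ψ₁ ζ‖ * kernelBound δ (z - ζ) := by
      rw [← integral_const_mul]
      refine norm_integral_le_of_norm_le ((hk _ hm₁ hb₁ z).const_mul _) ?_
      have h0 : ∀ᵐ ζ : ℂ, ζ ∉ ({z} : Set ℂ) := measure_eq_zero_iff_ae_notMem.1 (by simp)
      filter_upwards [h0] with ζ hζ
      by_cases hζD : ζ ∈ D
      · have := hgm ζ hζD z hz fun h => hζ h.symm
        rw [norm_mul, mul_left_comm]
        gcongr
        exact this
      · simp [ψ₁, hζD]
    have hfin : (F + (α • g + β • g ^ 2)) z - ∫ ζ, ψ ζ * (z - ζ)⁻¹ =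
        (F z - ∫ ζ, ψ₂ ζ * (z - ζ)⁻¹) +
          (α * g z + β * g z ^ 2 - ∫ ζ, ψ₁ ζ * (z - ζ)⁻¹) := by
      rw [hsplit]
      simp only [Pi.add_apply, Pi.smul_apply, Pi.pow_apply, smul_eq_mul]
      ring
    rw [hfin, hquad, hnsplit, mul_add]
    refine (norm_add_le _ _).trans ?_
    linarith [hFz z hz]

/-- A continuous function on a compact set extends to a continuous function on `ℂ` vanishing
off a disc. -/
lemma exists_continuous_extension {K : Set ℂ} (hK : IsCompact K) {f : ℂ → ℂ}
    (hf : ContinuousOn f K) :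
    ∃ F : ℂ → ℂ, Continuous F ∧ EqOn F f K ∧ ∃ R : ℝ, ∀ z, R ≤ ‖z‖ → F z = 0 := by
  obtain ⟨G, hG⟩ := ContinuousMap.exists_restrict_eq hK.isClosed ⟨K.domRestrict f, hf.domRestrict⟩
  obtain ⟨C, hC⟩ := hK.isBounded.exists_norm_le
  refine ⟨fun z => G z * (max 0 (min 1 (C + 1 - ‖z‖)) : ℝ), by fun_prop, fun z hz => ?_,
    C + 1, fun z hz => ?_⟩
  · have h1 : G z = f z := congrArg (fun F => F ⟨z, hz⟩) hG
    have h2 : min 1 (C + 1 - ‖z‖) = 1 := min_eq_left (by linarith [hC z hz])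
    simp [h1, h2]
  · have h2 : max 0 (min 1 (C + 1 - ‖z‖)) = 0 :=
      max_eq_left ((min_le_right _ _).trans (by linarith))
    simp [h2]

/-- **Mergelyan's theorem**. -/
theorem mem_polynomialClosure_of_differentiableOn_interior {K : Set ℂ} (hK : IsCompact K)
    (hconn : IsConnected Kᶜ) {f : ℂ → ℂ} (hf : ContinuousOn f K)
    (hd : DifferentiableOn ℂ f (interior K)) : f ∈ polynomialClosure hK := by
  obtain ⟨F, hF, hFf, R, hR⟩ := exists_continuous_extension hK hf
  refine mem_uniformClosureOn_congr ?_ fun z hz => (hFf hz).symm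
  have hsupp : HasCompactSupport F := by
    refine HasCompactSupport.intro (isCompact_closedBall 0 R) fun z hz => hR z ?_
    have : R < ‖z‖ := by simpa using hz
    exact this.le
  obtain ⟨M, hM⟩ := hF.bounded_above_of_compact_support hsupp
  have huc := hF.uniformContinuous_of_tendsto_cocompact hsupp.is_zero_at_infty
  refine mem_uniformClosureOn_of_approx fun ε hε => ?_
  set A : ℝ := 6 * 10 ^ 7 * Real.pi + 1 with hA
  have hA0 : 0 < A := by positivity
  obtain ⟨δ, hδ, hω⟩ := Metric.uniformContinuous_iff.1 huc (ε / (2 * A)) (by positivity)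
  set ω := ε / (2 * A) with hωdef
  have hω' (x y : ℂ) (h : ‖x - y‖ < δ) : ‖F x - F y‖ ≤ ω := by
    simpa [dist_eq_norm] using (hω (a := x) (b := y) (by simpa [dist_eq_norm] using h)).le
  let ψ := ballMoment F δ
  have hψ (ζ : ℂ) (hζ : ψ ζ ≠ 0) : ∃ x ∈ Kᶜ, dist ζ x < δ := by
    by_contra! h
    refine hζ (integral_ball_mul_eq_zero hF ?_)
    have hball : Metric.ball ζ δ ⊆ interior K := by
      refine Metric.isOpen_ball.subset_interior_iff.2 fun y hy => ?_
      by_contra hyK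
      have := h y hyK
      rw [Metric.mem_ball, dist_comm] at hy
      linarith
    exact (hd.mono hball).congr fun z hz => hFf (interior_subset (hball hz))
  have hψR := ballMoment_eq_zero_of_support (f := F) (δ := δ) hR
  have hcov : closure (Function.support ψ) ⊆ ⋃ x : (Kᶜ : Set ℂ), Metric.ball (x : ℂ) (2 * δ) := by
    intro ζ hζ
    obtain ⟨ζ', hζ', hd'⟩ := Metric.mem_closure_iff.1 hζ δ hδ
    obtain ⟨x, hx, hdx⟩ := hψ ζ' hζ'
    refine mem_iUnion.2 ⟨⟨x, hx⟩, ?_⟩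
    have := dist_triangle ζ ζ' x
    rw [Metric.mem_ball]
    linarith
  have hcomp : IsCompact (closure (Function.support ψ)) := by
    refine (isCompact_closedBall (0 : ℂ) (R + δ)).of_isClosed_subset isClosed_closure
      (closure_minimal (fun ζ hζ => ?_) Metric.isClosed_closedBall)
    by_contra h
    have : R + δ < ‖ζ‖ := by simpa using h
    exact hζ (hψR ζ this.le)
  obtain ⟨t, ht⟩ := hcomp.elim_finite_subcover _ (fun x => Metric.isOpen_ball) hcov
  obtain ⟨G, hG, hGz⟩ := exists_near_cauchyTransform hK hconn hδ (t.image Subtype.val)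
    (by
      intro x hx
      obtain ⟨y, _, rfl⟩ := Finset.mem_image.1 hx
      exact y.2)
    ψ (measurable_ballMoment hF) (norm_ballMoment_le hF hδ hω') hψR
    (fun ζ hζ => by
      obtain ⟨x, hx, hζx⟩ := mem_iUnion₂.1 (ht (subset_closure hζ))
      exact ⟨x, Finset.mem_image_of_mem _ hx, hζx⟩)
  set c : ℝ := Real.pi * (Real.pi * δ ^ 4 / 2) with hc
  have hc0 : 0 < c := by positivity
  refine ⟨((c : ℂ)⁻¹) • G, Subalgebra.smul_mem _ hG _, fun z hz => ?_⟩
  have hω0 : 0 < ω := by positivity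
  have h1 := hGz z hz
  have h2 : ∫ ζ, ‖ψ ζ‖ * kernelBound δ (z - ζ) ≤
      ω * δ * (Real.pi * δ ^ 2) * (Real.pi ^ 2 * δ) := by
    rw [← integral_kernelBound_sub hδ z, ← integral_const_mul]
    refine integral_mono_of_nonneg
      (.of_forall fun ζ => mul_nonneg (norm_nonneg _) (kernelBound_nonneg _ _))
      (((integrable_kernelBound hδ).comp_sub_left z).const_mul _) (.of_forall fun ζ => ?_)
    exact mul_le_mul_of_nonneg_right (norm_ballMoment_le hF hδ hω' ζ) (kernelBound_nonneg _ _)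
  rw [integral_ballMoment_mul_inv_sub hF hδ hM hR] at h1
  have h3 := norm_integral_mul_max_sub_le hF hδ hω' z
  set I := ∫ u, F (z + u) * (max 0 (δ ^ 2 - ‖u‖ ^ 2) : ℝ) with hI
  have h4 : ‖G z - c * F z‖ ≤ A * ω * c := by
    have e : G z - c * F z = (G z - Real.pi * I) +
        Real.pi * (I - (Real.pi * δ ^ 4 / 2 : ℝ) * F z) := by
      rw [hc]; push_cast; ring
    rw [e]
    refine (norm_add_le _ _).trans ?_
    rw [norm_mul, norm_real, Real.norm_eq_abs, abs_of_pos Real.pi_pos]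
    have h5 := mul_le_mul_of_nonneg_left h3 Real.pi_pos.le
    have h6 := mul_le_mul_of_nonneg_left h2 (by norm_num : (0 : ℝ) ≤ 3 * 10 ^ 7)
    calc _ ≤ 3 * 10 ^ 7 * (ω * δ * (Real.pi * δ ^ 2) * (Real.pi ^ 2 * δ)) +
          Real.pi * (ω * (Real.pi * δ ^ 4 / 2)) := by linarith
      _ = A * ω * c := by rw [hA, hc]; ring
  have h7 : F z - (((c : ℂ)⁻¹) • G) z = -((c : ℂ)⁻¹ * (G z - c * F z)) := by
    have : (c : ℂ) ≠ 0 := by exact_mod_cast hc0.ne'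
    simp only [Pi.smul_apply, smul_eq_mul]
    field_simp
    ring
  rw [h7, norm_neg, norm_mul, norm_inv, norm_real, Real.norm_eq_abs, abs_of_pos hc0,
    inv_mul_lt_iff₀ hc0]
  refine h4.trans_lt ?_
  have : A * ω = ε / 2 := by rw [hωdef]; field_simp
  rw [this]
  nlinarith

lemma IsDirichletPolynomial.differentiable {f : ℂ → ℂ} (hf : IsDirichletPolynomial f) :
    Differentiable ℂ f := by
  obtain ⟨m, a, h⟩ := hf
  obtain rfl := funext h
  refine Differentiable.fun_sum fun k hk => (differentiable_const _).mul ?_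
  have hk0 : (k : ℂ) ≠ 0 := by
    have := (Finset.mem_Icc.1 hk).1
    exact_mod_cast (by omega : k ≠ 0)
  exact differentiable_neg.const_cpow (Or.inl hk0)

lemma IsDirichletPolynomial.add {f g : ℂ → ℂ} (hf : IsDirichletPolynomial f)
    (hg : IsDirichletPolynomial g) : IsDirichletPolynomial (f + g) := by
  obtain ⟨m, a, hf⟩ := hf
  obtain ⟨n, b, hg⟩ := hg
  have pad (m n : ℕ) (a : ℕ → ℂ) (z : ℂ) : ∑ k ∈ Finset.Icc 1 m, a k * (k : ℂ) ^ (-z) =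
      ∑ k ∈ Finset.Icc 1 (m + n), (if k ≤ m then a k else 0) * (k : ℂ) ^ (-z) := by
    refine Finset.sum_subset_zero_on_sdiff (Finset.Icc_subset_Icc_right (by omega)) ?_ ?_
    · intro k hk
      simp only [Finset.mem_sdiff, Finset.mem_Icc] at hk
      rw [if_neg (by omega), zero_mul]
    · intro k hk
      rw [if_pos (Finset.mem_Icc.1 hk).2]
  refine ⟨m + n, fun k => (if k ≤ m then a k else 0) + (if k ≤ n then b k else 0), fun z => ?_⟩
  rw [Pi.add_apply, hf, hg, pad m n a, pad n m b, add_comm n m, ← Finset.sum_add_distrib]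
  simp only [add_mul]

lemma IsDirichletPolynomial.smul {f : ℂ → ℂ} (c : ℂ) (hf : IsDirichletPolynomial f) :
    IsDirichletPolynomial (c • f) := by
  obtain ⟨m, a, hf⟩ := hf
  exact ⟨m, fun k => c * a k, fun z => by simp [hf, Finset.mul_sum, mul_assoc]⟩

/-- The monoid of functions `z ↦ k ^ (-z)` with `k` a positive integer. -/
def dirichletMonoid : Submonoid (ℂ → ℂ) where
  carrier := {f | ∃ k : ℕ, 0 < k ∧ f = fun z => (k : ℂ) ^ (-z)}
  one_mem' := ⟨1, one_pos, by ext; simp⟩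
  mul_mem' := by
    rintro _ _ ⟨k, hk, rfl⟩ ⟨l, hl, rfl⟩
    refine ⟨k * l, by positivity, ?_⟩
    ext z
    rw [Pi.mul_apply, Nat.cast_mul, natCast_mul_natCast_cpow]

/-- The algebra of Dirichlet polynomials. -/
noncomputable def dirichletAlgebra : Subalgebra ℂ (ℂ → ℂ) :=
  Algebra.adjoin ℂ (dirichletMonoid : Set (ℂ → ℂ))

lemma isDirichletPolynomial_of_mem {f : ℂ → ℂ} (hf : f ∈ dirichletAlgebra) :
    IsDirichletPolynomial f := by
  rw [dirichletAlgebra, ← Subalgebra.mem_toSubmodule, Algebra.adjoin_eq_span,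
    Submonoid.closure_eq] at hf
  induction hf using Submodule.span_induction with
  | mem f hf =>
    obtain ⟨k, hk, rfl⟩ := hf
    refine ⟨k, fun j => if j = k then 1 else 0, fun z => ?_⟩
    rw [Finset.sum_eq_single_of_mem k (Finset.mem_Icc.2 ⟨hk, le_rfl⟩)
      (fun j _ hj => by simp [hj])]
    simp
  | zero => exact ⟨0, 0, by simp⟩
  | add f g _ _ hf hg => exact hf.add hg
  | smul c f _ hf => exact hf.smul c

lemma bounded_of_mem_dirichletAlgebra {K : Set ℂ} (hK : IsCompact K) :
    ∀ p ∈ dirichletAlgebra, ∃ C : ℝ, ∀ z ∈ K, ‖p z‖ ≤ C := fun _ hf =>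
  hK.exists_bound_of_continuousOn
    (isDirichletPolynomial_of_mem hf).differentiable.continuous.continuousOn

/-- The uniform closure of the Dirichlet polynomials on a compact set. -/
noncomputable def dirichletClosure {K : Set ℂ} (hK : IsCompact K) : Subalgebra ℂ (ℂ → ℂ) :=
  uniformClosureOn dirichletAlgebra K (bounded_of_mem_dirichletAlgebra hK)

lemma integrableOn_cpow_mul_exp_neg_mul {w : ℂ} (hw : 0 < w.re) {t : ℝ} (ht : 0 < t) :
    IntegrableOn (fun x : ℝ => (x : ℂ) ^ (w - 1) * exp (-(t * x))) (Ioi 0) := by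
  refine not_imp_comm.1 integral_undef ?_
  rw [integral_cpow_mul_exp_neg_mul_Ioi hw (by simpa using ht)]
  exact mul_ne_zero (by simp [cpow_eq_zero_iff, ht.ne']) (Gamma_ne_zero_of_re_pos hw)

lemma integral_cpow_mul_exp_neg_mul_eq {w : ℂ} (hw : 0 < w.re) {t : ℝ} (ht : 0 < t) :
    ∫ x : ℝ in Ioi 0, (x : ℂ) ^ (w - 1) * exp (-(t * x)) = (t : ℂ) ^ (-w) * Gamma w := by
  rw [integral_cpow_mul_exp_neg_mul_Ioi hw (by simpa using ht), one_div, cpow_neg,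
    inv_cpow]
  rw [arg_ofReal_of_nonneg ht.le]
  exact Real.pi_pos.ne

/-- For `t ≥ 1`, the function `t ^ (-w)` is approximated by Dirichlet polynomials, up to a
quotient of Gamma functions. -/
lemma exists_sum_near_cpow {t : ℝ} (ht : 1 ≤ t) {ε : ℝ} (hε : 0 < ε) :
    ∃ Q : Polynomial ℝ, ∀ w : ℂ, 0 < w.re →
      ‖(t : ℂ) ^ (-w) - ∑ j ∈ Finset.range (Q.natDegree + 1),
        (Q.coeff j : ℂ) * ((j + 1 : ℕ) : ℂ) ^ (-w)‖ * ‖Gamma w‖ ≤ ε * Real.Gamma w.re := by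
  obtain ⟨Q, hQ⟩ := exists_polynomial_near_of_continuousOn 0 1 (fun u => u ^ (t - 1))
    (Real.continuous_rpow_const (by linarith)).continuousOn ε hε
  refine ⟨Q, fun w hw => ?_⟩
  have ht0 : 0 < t := by linarith
  have hj0 (j : ℕ) : (0 : ℝ) < (j + 1 : ℕ) := by positivity
  rw [← norm_mul, sub_mul, Finset.sum_mul, ← integral_cpow_mul_exp_neg_mul_eq hw ht0]
  have hsum : ∑ j ∈ Finset.range (Q.natDegree + 1),
      (Q.coeff j : ℂ) * ((j + 1 : ℕ) : ℂ) ^ (-w) * Gamma w =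
      ∫ x : ℝ in Ioi 0, ∑ j ∈ Finset.range (Q.natDegree + 1),
        (Q.coeff j : ℂ) * ((x : ℂ) ^ (w - 1) * exp (-(((j + 1 : ℕ) : ℝ) * x))) := by
    rw [integral_finsetSum _ fun j _ =>
      (integrableOn_cpow_mul_exp_neg_mul hw (hj0 j)).const_mul _]
    refine Finset.sum_congr rfl fun j _ => ?_
    rw [integral_const_mul, integral_cpow_mul_exp_neg_mul_eq hw (hj0 j), ofReal_natCast, mul_assoc]
  rw [hsum, ← integral_sub (integrableOn_cpow_mul_exp_neg_mul hw ht0)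
    (integrable_finsetSum _ fun j _ =>
      (integrableOn_cpow_mul_exp_neg_mul hw (hj0 j)).const_mul _),
    Real.Gamma_eq_integral hw, ← integral_const_mul]
  refine norm_integral_le_of_norm_le ((Real.GammaIntegral_convergent hw).const_mul ε)
    (ae_restrict_of_forall_mem measurableSet_Ioi fun x hx => ?_)
  have hx : 0 < x := hx
  set u := Real.exp (-x) with hu
  have hu0 : 0 < u := Real.exp_pos _
  have hu1 : u ≤ 1 := Real.exp_le_one_iff.2 (by linarith)
  have hut : Real.exp (-(t * x)) = u * u ^ (t - 1) := by
    rw [hu, ← Real.exp_mul, ← Real.exp_add]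
    congr 1
    ring
  have huj (j : ℕ) : Real.exp (-(((j + 1 : ℕ) : ℝ) * x)) = u * u ^ j := by
    rw [hu, ← Real.exp_nat_mul, ← Real.exp_add]
    congr 1
    push_cast
    ring
  have key : (x : ℂ) ^ (w - 1) * exp (-(t * x)) - ∑ j ∈ Finset.range (Q.natDegree + 1),
      (Q.coeff j : ℂ) * ((x : ℂ) ^ (w - 1) * exp (-(((j + 1 : ℕ) : ℝ) * x))) =
      (x : ℂ) ^ (w - 1) * ((u * (u ^ (t - 1) - Q.eval u) : ℝ) : ℂ) := by
    rw [Polynomial.eval_eq_sum_range, mul_sub, ← hut, Finset.mul_sum, ofReal_sub, mul_sub,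
      ofReal_sum, Finset.mul_sum]
    congr 1
    · push_cast; rfl
    · refine Finset.sum_congr rfl fun j _ => ?_
      rw [mul_left_comm u, ← huj]
      push_cast
      ring
  rw [key, norm_mul, norm_real, norm_cpow_eq_rpow_re_of_pos hx, Real.norm_eq_abs, abs_mul,
    abs_of_pos hu0, abs_sub_comm, sub_re, one_re]
  have h1 := (hQ u ⟨hu0.le, hu1⟩).le
  calc x ^ (w.re - 1) * (u * |Q.eval u - u ^ (t - 1)|) ≤ x ^ (w.re - 1) * (u * ε) := by gcongr
    _ = ε * (u * x ^ (w.re - 1)) := by ring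

lemma cpow_neg_mem_dirichletClosure {K : Set ℂ} (hK : IsCompact K) {t : ℝ} (ht : 1 ≤ t) :
    (fun z => (t : ℂ) ^ (-z)) ∈ dirichletClosure hK := by
  obtain ⟨B, hB⟩ := hK.isBounded.exists_norm_le
  set a : ℝ := B + 1 with ha
  have hre (z : ℂ) (hz : z ∈ K) : 0 < (z + a).re := by
    have h1 := hB z hz
    have h2 := (abs_le.1 (abs_re_le_norm z)).1
    simp only [add_re, ofReal_re]
    linarith
  have hcont : ContinuousOn (fun z : ℂ => Real.Gamma (z + a).re / ‖Gamma (z + a)‖) K := by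
    intro z hz
    have h1 : ContinuousAt (fun z : ℂ => Real.Gamma (z + a).re) z := by
      refine ContinuousAt.comp (g := Real.Gamma) (f := fun z : ℂ => (z + a).re) ?_
        (continuous_re.comp (continuous_add_const (a : ℂ))).continuousAt
      refine (Real.differentiableAt_Gamma fun m h => ?_).continuousAt
      have := hre z hz
      rw [h] at this
      linarith [(Nat.cast_nonneg m : (0 : ℝ) ≤ m)]
    have h2 : ContinuousAt (fun z : ℂ => Gamma (z + a)) z := by
      refine ContinuousAt.comp (f := fun z : ℂ => z + a) ?_ (by fun_prop)
      refine (differentiableAt_Gamma _ fun m h => ?_).continuousAt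
      have := hre z hz
      rw [h] at this
      simp only [neg_re, natCast_re] at this
      linarith [(Nat.cast_nonneg m : (0 : ℝ) ≤ m)]
    exact (h1.div h2.norm
      (norm_ne_zero_iff.2 (Gamma_ne_zero_of_re_pos (hre z hz)))).continuousWithinAt
  obtain ⟨C, hC⟩ := hK.exists_bound_of_continuousOn hcont
  intro ε hε
  have ht0 : 0 < t := by linarith
  have htC : (t : ℂ) ≠ 0 := by exact_mod_cast ht0.ne'
  obtain ⟨Q, hQ⟩ := exists_sum_near_cpow ht
    (ε := ε / (t ^ a * (|C| + 1))) (by positivity)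
  have hmem (j : ℕ) : (fun z : ℂ => ((j + 1 : ℕ) : ℂ) ^ (-z)) ∈ dirichletAlgebra :=
    Algebra.subset_adjoin ⟨j + 1, by omega, rfl⟩
  refine ⟨∑ j ∈ Finset.range (Q.natDegree + 1),
    ((t : ℂ) ^ (a : ℂ) * Q.coeff j * ((j + 1 : ℕ) : ℂ) ^ (-(a : ℂ))) •
      fun z : ℂ => ((j + 1 : ℕ) : ℂ) ^ (-z), Subalgebra.sum_mem _ fun j _ =>
    Subalgebra.smul_mem _ (hmem j) _, fun z hz => ?_⟩
  have e : (t : ℂ) ^ (-z) - (∑ j ∈ Finset.range (Q.natDegree + 1),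
      ((t : ℂ) ^ (a : ℂ) * Q.coeff j * ((j + 1 : ℕ) : ℂ) ^ (-(a : ℂ))) •
        fun z : ℂ => ((j + 1 : ℕ) : ℂ) ^ (-z)) z = (t : ℂ) ^ (a : ℂ) *
      ((t : ℂ) ^ (-(z + a)) - ∑ j ∈ Finset.range (Q.natDegree + 1),
        (Q.coeff j : ℂ) * ((j + 1 : ℕ) : ℂ) ^ (-(z + a))) := by
    rw [mul_sub, ← cpow_add _ _ htC, Finset.sum_apply, Finset.mul_sum]
    congr 2
    · ring
    · ext j
      have hj : ((j + 1 : ℕ) : ℂ) ≠ 0 := by exact_mod_cast Nat.succ_ne_zero j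
      rw [neg_add, cpow_add _ _ hj, Pi.smul_apply, smul_eq_mul]
      ring
  rw [e, norm_mul, norm_cpow_eq_rpow_re_of_pos ht0, ofReal_re]
  have hG : 0 < ‖Gamma (z + a)‖ := norm_pos_iff.2 (Gamma_ne_zero_of_re_pos (hre z hz))
  have h1 := (le_div_iff₀ hG).2 (hQ (z + a) (hre z hz))
  have h2 := (le_abs_self _).trans ((hC z hz).trans (le_abs_self C))
  have hta : 0 < t ^ a := Real.rpow_pos_of_pos ht0 a
  rw [mul_div_assoc] at h1
  calc _ ≤ t ^ a * (ε / (t ^ a * (|C| + 1)) * |C|) := by gcongr; exact h1.trans (by gcongr)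
    _ = ε * (|C| / (|C| + 1)) := by field_simp
    _ < ε * 1 := by
      gcongr
      rw [div_lt_one (by positivity)]
      linarith
    _ = ε := mul_one ε

lemma id_mem_dirichletClosure {K : Set ℂ} (hK : IsCompact K) :
    (fun z => z) ∈ dirichletClosure hK := by
  obtain ⟨B, hB⟩ := hK.isBounded.exists_norm_le
  refine mem_uniformClosureOn_of_approx fun ε hε => ?_
  set b := |B| + 1 with hb
  have hb0 : 0 < b := by positivity
  obtain ⟨h, h0, hh⟩ := exists_between (lt_min (inv_pos.2 hb0) (by positivity : 0 < ε / b ^ 2))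
  obtain ⟨hh1, hh2⟩ := lt_min_iff.1 hh
  refine ⟨(h : ℂ)⁻¹ • ((fun _ => 1) - fun z : ℂ => (Real.exp h : ℂ) ^ (-z)),
    Subalgebra.smul_mem _ (Subalgebra.sub_mem _ (const_mem_uniformClosureOn 1)
      (cpow_neg_mem_dirichletClosure hK (Real.one_le_exp h0.le))) _, fun z hz => ?_⟩
  have hz' : ‖z‖ ≤ b := by linarith [hB z hz, le_abs_self B]
  have hC : (h : ℂ) ≠ 0 := by exact_mod_cast h0.ne'
  have hpow : (Real.exp h : ℂ) ^ (-z) = exp (-(h * z)) := by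
    rw [cpow_def_of_ne_zero (by exact_mod_cast (Real.exp_pos h).ne'),
      ← ofReal_log (Real.exp_pos h).le, Real.log_exp]
    ring_nf
  have hn : ‖-((h : ℂ) * z)‖ = h * ‖z‖ := by
    rw [norm_neg, norm_mul, norm_real, Real.norm_eq_abs, abs_of_pos h0]
  have hle : h * ‖z‖ ≤ 1 := by
    calc h * ‖z‖ ≤ b⁻¹ * b := by gcongr
      _ = 1 := inv_mul_cancel₀ hb0.ne'
  have h1 := norm_exp_sub_one_sub_id_le (hn.trans_le hle)
  rw [hn] at h1
  have e : z - ((h : ℂ)⁻¹ • ((fun _ => 1) - fun z : ℂ => (Real.exp h : ℂ) ^ (-z)) : ℂ → ℂ) z =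
      (h : ℂ)⁻¹ * (exp (-(h * z)) - 1 - -(h * z)) := by
    simp only [Pi.smul_apply, Pi.sub_apply, smul_eq_mul, hpow]
    field_simp
    ring
  rw [e, norm_mul, norm_inv, norm_real, Real.norm_eq_abs, abs_of_pos h0, inv_mul_lt_iff₀ h0]
  have h3 : h * b ^ 2 < ε := (lt_div_iff₀ (by positivity)).1 hh2
  calc _ ≤ (h * ‖z‖) ^ 2 := h1
    _ ≤ (h * b) ^ 2 := by gcongr
    _ = h * (h * b ^ 2) := by ring
    _ < h * ε := by gcongr

lemma polynomialClosure_le_dirichletClosure {K : Set ℂ} (hK : IsCompact K) :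
    polynomialClosure hK ≤ dirichletClosure hK := by
  intro f hf
  refine mem_uniformClosureOn_of_approx fun ε hε => ?_
  obtain ⟨p, ⟨q, hq⟩, hpf⟩ := hf ε hε
  refine ⟨p, ?_, hpf⟩
  have : p ∈ Algebra.adjoin ℂ {fun z : ℂ => z} := by
    rw [← hq]
    exact Polynomial.aeval_mem_adjoin_singleton ℂ _
  exact Algebra.adjoin_le (singleton_subset_iff.2 (id_mem_dirichletClosure hK)) this

/-- If the reciprocals of quadratic polynomials with conjugate zeros off `K` are uniform limits
on `K` of entire functions, then `K` has connected complement. -/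
lemma isConnected_compl_of_approx {K : Set ℂ} (hK : IsCompact K)
    (hsym : (starRingEnd ℂ) '' K = K)
    (h : ∀ f : ℂ → ℂ, ContinuousOn f K → DifferentiableOn ℂ f (interior K) →
      (∀ z ∈ K, f z = starRingEnd ℂ (f (starRingEnd ℂ z))) →
      ∀ ε > 0, ∃ p : ℂ → ℂ, Differentiable ℂ p ∧ ∀ z ∈ K, ‖f z - p z‖ < ε) :
    IsConnected Kᶜ := by
  obtain ⟨B, hB⟩ := hK.isBounded.exists_norm_le
  set ρ := |B| + 1 with hρ
  have hρ0 : 0 < ρ := by positivity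
  let E : Set ℂ := {z | ρ < ‖z‖}
  have hE : IsPreconnected E := by simpa using isPreconnected_norm_sub_gt 0 hρ0
  have hEK : E ⊆ Kᶜ := fun z hz hzK => by
    have h1 : ρ < ‖z‖ := hz
    linarith [hB z hzK, le_abs_self B]
  have hx : ((ρ + 1 : ℝ) : ℂ) ∈ E := by
    simp only [E, mem_ofPred_eq, norm_real, Real.norm_eq_abs]
    linarith [le_abs_self (ρ + 1)]
  refine ⟨⟨_, hEK hx⟩, isPreconnected_of_forall ((ρ + 1 : ℝ) : ℂ) fun a ha => ?_⟩
  let U := connectedComponentIn Kᶜ a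
  have haU : a ∈ U := mem_connectedComponentIn ha
  have hUK : U ⊆ Kᶜ := connectedComponentIn_subset _ _
  have hUo : IsOpen U := hK.isClosed.isOpen_compl.connectedComponentIn
  suffices hmeet : (U ∩ E).Nonempty by
    obtain ⟨y, hyU, hyE⟩ := hmeet
    exact ⟨U ∪ E, union_subset hUK hEK, Or.inr hx, Or.inl haU,
      isPreconnected_connectedComponentIn.union y hyU hyE hE⟩
  by_contra hdis
  have hUb : Bornology.IsBounded U := by
    refine isBounded_iff_forall_norm_le.2 ⟨ρ, fun z hz => ?_⟩
    by_contra! hlt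
    exact hdis ⟨z, hz, hlt⟩
  have hfr : frontier U ⊆ K := by
    intro z hz
    by_contra hzK
    have hVo : IsOpen (connectedComponentIn Kᶜ z) := hK.isClosed.isOpen_compl.connectedComponentIn
    have hzV : z ∈ connectedComponentIn Kᶜ z := mem_connectedComponentIn hzK
    obtain ⟨y, hyV, hyU⟩ := mem_closure_iff.1 hz.1 _ hVo hzV
    have h1 := connectedComponentIn_eq hyV
    have h2 : connectedComponentIn Kᶜ a = connectedComponentIn Kᶜ y := connectedComponentIn_eq hyU
    rw [h1, ← h2] at hzV
    exact hz.2 (hUo.interior_eq.symm ▸ hzV)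
  have hmem (z : ℂ) (hz : z ∈ K) : starRingEnd ℂ z ∈ K := hsym ▸ mem_image_of_mem _ hz
  let s : ℂ → ℂ := fun z => (z - a) * (z - starRingEnd ℂ a)
  have hsd : Differentiable ℂ s := by fun_prop
  have hs0 (z : ℂ) (hz : z ∈ K) : s z ≠ 0 := by
    refine mul_ne_zero (sub_ne_zero.2 ?_) (sub_ne_zero.2 ?_)
    · rintro rfl
      exact ha hz
    · rintro rfl
      exact ha (by simpa using hmem _ hz)
  have hd : DifferentiableOn ℂ (fun z => (s z)⁻¹) K := hsd.differentiableOn.fun_inv hs0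
  obtain ⟨C, hC⟩ := hK.exists_bound_of_continuousOn hsd.continuous.continuousOn
  obtain ⟨p, hp, hpK⟩ := h (fun z => (s z)⁻¹) hd.continuousOn (hd.mono interior_subset)
    (fun z _ => by simp [s, mul_comm]) (1 / (2 * (|C| + 1))) (by positivity)
  have hmax := norm_le_of_forall_mem_frontier_norm_le (f := fun z => 1 - p z * s z) (C := 1 / 2)
    hUb (((differentiable_const 1).sub (hp.mul hsd)).diffContOnCl) (fun z hz => ?_)
    (subset_closure haU)
  · norm_num [s] at hmax
  · have hzK := hfr hz
    have e : 1 - p z * s z = ((s z)⁻¹ - p z) * s z := by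
      rw [sub_mul, inv_mul_cancel₀ (hs0 z hzK)]
    rw [e, norm_mul]
    have h1 : ‖s z‖ ≤ |C| + 1 := by linarith [hC z hzK, le_abs_self C]
    calc _ ≤ 1 / (2 * (|C| + 1)) * (|C| + 1) := by
          gcongr
          exact (hpK z hzK).le
      _ = 1 / 2 := by field_simp

/-- Averaging an approximation with its reflection. -/
lemma norm_sub_symmetrization_lt {K : Set ℂ} (hsym : (starRingEnd ℂ) '' K = K) {f p : ℂ → ℂ}
    (hf : ∀ z ∈ K, f z = starRingEnd ℂ (f (starRingEnd ℂ z))) {ε : ℝ}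
    (hp : ∀ z ∈ K, ‖f z - p z‖ < ε) (z : ℂ) (hz : z ∈ K) :
    ‖f z - (1 / 2) * (p z + starRingEnd ℂ (p (starRingEnd ℂ z)))‖ < ε := by
  have h1 := hp z hz
  have h2 := hp (starRingEnd ℂ z) (hsym ▸ mem_image_of_mem _ hz)
  rw [← norm_conj, map_sub, ← hf z hz] at h2
  have e : f z - (1 / 2) * (p z + starRingEnd ℂ (p (starRingEnd ℂ z))) =
      (1 / 2) * ((f z - p z) + (f z - starRingEnd ℂ (p (starRingEnd ℂ z)))) := by ring
  rw [e, norm_mul]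
  have h3 := norm_add_le (f z - p z) (f z - starRingEnd ℂ (p (starRingEnd ℂ z)))
  norm_num
  linarith

lemma IsDirichletPolynomial.conj_conj {D : ℂ → ℂ} (hD : IsDirichletPolynomial D) :
    IsDirichletPolynomial fun z => starRingEnd ℂ (D (starRingEnd ℂ z)) := by
  obtain ⟨m, a, h⟩ := hD
  refine ⟨m, fun k => starRingEnd ℂ (a k), fun z => ?_⟩
  beta_reduce
  rw [h, map_sum]
  refine Finset.sum_congr rfl fun k _ => ?_
  have harg : (k : ℂ).arg ≠ Real.pi := by
    rw [natCast_arg]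
    exact Real.pi_pos.ne
  rw [map_mul, ← map_neg, cpow_conj _ _ harg]
  simp

/-- Real-symmetric Mergelyan theorem: for a real-symmetric compact set `K ⊆ ℂ`, the
following are equivalent: (a) `ℂ \ K` is connected; (b) every real-symmetric function in
`A(K)` is a uniform limit on `K` of real-symmetric algebraic polynomials; (c) every
real-symmetric function in `A(K)` is a uniform limit on `K` of real-symmetric Dirichlet
polynomials. -/
theorem symmetric_mergelyan (K : Set ℂ) (hK : IsCompact K)
    (hsym : (starRingEnd ℂ) '' K = K) :
    (IsConnected Kᶜ ↔
      ∀ f : ℂ → ℂ, ContinuousOn f K → DifferentiableOn ℂ f (interior K) →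
        (∀ z ∈ K, f z = starRingEnd ℂ (f (starRingEnd ℂ z))) →
        ∀ ε > 0, ∃ p : Polynomial ℂ,
          (∀ z : ℂ, p.eval (starRingEnd ℂ z) = starRingEnd ℂ (p.eval z)) ∧
          ∀ z ∈ K, ‖f z - p.eval z‖ < ε) ∧
    (IsConnected Kᶜ ↔
      ∀ f : ℂ → ℂ, ContinuousOn f K → DifferentiableOn ℂ f (interior K) →
        (∀ z ∈ K, f z = starRingEnd ℂ (f (starRingEnd ℂ z))) →
        ∀ ε > 0, ∃ D : ℂ → ℂ, IsDirichletPolynomial D ∧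
          (∀ z : ℂ, D (starRingEnd ℂ z) = starRingEnd ℂ (D z)) ∧
          ∀ z ∈ K, ‖f z - D z‖ < ε) := by
  refine ⟨⟨fun hconn f hc hd hf ε hε => ?_, fun h => ?_⟩,
    ⟨fun hconn f hc hd hf ε hε => ?_, fun h => ?_⟩⟩
  · obtain ⟨g, hg, hfg⟩ := mem_polynomialClosure_of_differentiableOn_interior hK hconn hc hd ε hε
    obtain ⟨p, hp⟩ := mem_polynomialAlgebra.1 hg
    obtain rfl := funext hp
    have heval (z : ℂ) : (Polynomial.C (1 / 2) * (p + p.map (starRingEnd ℂ))).eval z =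
        (1 / 2) * (p.eval z + starRingEnd ℂ (p.eval (starRingEnd ℂ z))) := by
      have := Polynomial.eval_map_apply (p := p) (f := starRingEnd ℂ) (starRingEnd ℂ z)
      rw [conj_conj] at this
      rw [Polynomial.eval_mul, Polynomial.eval_C, Polynomial.eval_add, this]
    refine ⟨Polynomial.C (1 / 2) * (p + p.map (starRingEnd ℂ)), fun z => ?_, fun z hz => ?_⟩
    · rw [heval, heval]
      simp [add_comm, conj_ofNat]
    · rw [heval]
      exact norm_sub_symmetrization_lt hsym hf hfg z hz
  · refine isConnected_compl_of_approx hK hsym fun f hc hd hf ε hε => ?_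
    obtain ⟨p, _, hp⟩ := h f hc hd hf ε hε
    exact ⟨_, p.differentiable, hp⟩
  · obtain ⟨g, hg, hfg⟩ := polynomialClosure_le_dirichletClosure hK
      (mem_polynomialClosure_of_differentiableOn_interior hK hconn hc hd) ε hε
    have hD := isDirichletPolynomial_of_mem hg
    refine ⟨(1 / 2 : ℂ) • (g + fun z => starRingEnd ℂ (g (starRingEnd ℂ z))),
      (hD.add hD.conj_conj).smul _, fun z => by simp [add_comm, conj_ofNat], fun z hz => ?_⟩
    exact norm_sub_symmetrization_lt hsym hf hfg z hz
  · refine isConnected_compl_of_approx hK hsym fun f hc hd hf ε hε => ?_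
    obtain ⟨D, hD, _, hp⟩ := h f hc hd hf ε hε
    exact ⟨D, hD.differentiable, hp⟩
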